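/- arXiv:2208.07229 — 10 statements merged into one kernel-verified Lean document; each statement's English description precedes it below -/
import Mathlib

section
/- Let G be a simple graph on n vertices with adjacency matrix A, and let m ≥ 2 be an integer. Let Ã = A(P_m) ⊗ I_n + D_1 ⊗ A be the adjacency matrix of the rooted product G∘P_m, let W(G) and W(G∘P_m) be the walk matrices of G and G∘P_m respectively, and let a_0 = (−1)^n det A be the constant term of the characteristic polynomial of G. Then det W(G∘P_m) = ε · a_0^⌊m/2⌋ · (det W(G))^m for some ε ∈ {1, −1}. -/
open Polynomial Matrix Kronecker

/-- The walk matrix `[e, Me, M²e, …, M^{N-1}e]` of an `N × N` real matrix `M`. -/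
noncomputable def walkMatrix {N : ℕ} (M : Matrix (Fin N) (Fin N) ℝ) :
    Matrix (Fin N) (Fin N) ℝ :=
  Matrix.of fun i k => (M ^ (k : ℕ)).mulVec (fun _ => (1 : ℝ)) i

/-- The adjacency matrix of the path `P_m` on `m` vertices. -/
noncomputable def pathAdj (m : ℕ) : Matrix (Fin m) (Fin m) ℝ :=
  Matrix.of fun i j => if (i : ℕ) + 1 = (j : ℕ) ∨ (j : ℕ) + 1 = (i : ℕ) then 1 else 0

/-- The diagonal matrix `diag(1,0,…,0)`. -/
noncomputable def D1 (m : ℕ) : Matrix (Fin m) (Fin m) ℝ :=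
  Matrix.of fun i j => if i = j ∧ (i : ℕ) = 0 then 1 else 0

section ChebyshevIdentities

open Polynomial.Chebyshev

variable (R : Type*) [CommRing R]

theorem chebyshevS_double (k : ℕ) :
    S R (2 * k) = (S R k + S R (k - 1)) * (S R k - S R (k - 1)) ∧
      S R (2 * k + 1) = S R k * (S R (k + 1) - S R (k - 1)) := by
  induction k with
  | zero => simp
  | succ k ih =>
    obtain ⟨h₀, h₁⟩ := ih
    have a₁ := S_add_one R k
    have a₂ := S_add_two R k
    have e₀ := S_add_two R (2 * k)
    have e₁ := S_add_one R (2 * k + 1 + 1)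
    push_cast
    rw [show (2 * ((k : ℤ) + 1)) = 2 * k + 2 by ring,
      show (2 * (k : ℤ) + 2 + 1) = 2 * k + 1 + 1 + 1 by ring,
      show ((k : ℤ) + 1 - 1) = k by ring, show ((k : ℤ) + 1 + 1) = k + 2 by ring]
    rw [show (2 * (k : ℤ) + 1 + 1) = 2 * k + 2 by ring,
      show (2 * (k : ℤ) + 2 - 1) = 2 * k + 1 by ring] at e₁
    have h₂ : S R (2 * k + 2) = (S R (k + 1) + S R k) * (S R (k + 1) - S R k) := by
      rw [e₀, h₀, h₁, a₁]; ring
    refine ⟨h₂, ?_⟩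
    rw [show (2 * (k : ℤ) + 1 + 1 + 1) = 2 * k + 2 + 1 by ring, e₁, h₂, h₁, a₂, a₁]
    ring

theorem chebyshevS_sum (k : ℕ) :
    ∑ j ∈ Finset.range (2 * k), S R (j : ℤ) = S R (k - 1) * (S R k + S R (k - 1)) ∧
      ∑ j ∈ Finset.range (2 * k + 1), S R (j : ℤ) = S R k * (S R k + S R (k - 1)) := by
  have step (k : ℕ)
      (h : ∑ j ∈ Finset.range (2 * k), S R (j : ℤ) = S R (k - 1) * (S R k + S R (k - 1))) :
      ∑ j ∈ Finset.range (2 * k + 1), S R (j : ℤ) = S R k * (S R k + S R (k - 1)) := by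
    rw [Finset.sum_range_succ, h]
    push_cast
    rw [(chebyshevS_double R k).1]
    ring
  have even : ∑ j ∈ Finset.range (2 * k), S R (j : ℤ) = S R (k - 1) * (S R k + S R (k - 1)) := by
    induction k with
    | zero => simp
    | succ k ih =>
      rw [show 2 * (k + 1) = 2 * k + 1 + 1 by ring, Finset.sum_range_succ, step k ih]
      push_cast
      rw [(chebyshevS_double R k).2, show ((k : ℤ) + 1 - 1) = k by ring]
      ring
  exact ⟨even, step k even⟩

theorem chebyshevS_monic_degree [Nontrivial R] (k : ℕ) :
    (S R k).Monic ∧ (S R k).degree = k ∧ (S R (k - 1)).degree < k := by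
  induction k with
  | zero => simp
  | succ k ih =>
    obtain ⟨hm, hd, hlt⟩ := ih
    have hX : (X * S R (k : ℤ)).degree = ((k + 1 : ℕ) : WithBot ℕ) := by
      rw [hm.degree_mul, degree_X, hd, add_comm]; rfl
    have hlt' : (S R (k - 1)).degree < (X * S R k).degree := by
      rw [hX]
      exact hlt.trans (by exact_mod_cast Nat.lt_succ_self k)
    push_cast
    rw [S_add_one, show ((k : ℤ) + 1 - 1) = k by ring]
    refine ⟨(monic_X.mul hm).sub_of_left hlt', ?_, ?_⟩
    · rw [degree_sub_eq_left_of_degree_lt hlt', hX]; rfl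
    · rw [hd]; exact_mod_cast Nat.lt_succ_self k

theorem chebyshevS_add_monic_natDegree [Nontrivial R] (k : ℕ) :
    (S R k + S R (k - 1)).Monic ∧ (S R k + S R (k - 1)).natDegree = k := by
  obtain ⟨hm, hd, hlt⟩ := chebyshevS_monic_degree R k
  rw [← hd] at hlt
  refine ⟨hm.add_of_left hlt, natDegree_eq_of_degree_eq_some ?_⟩
  rw [degree_add_eq_left_of_degree_lt hlt, hd]

/-- The sum of the characteristic polynomials of the paths on fewer than `m` vertices splits into
a factor of `S m` of degree `m / 2` and a factor of `S (m - 1)`. -/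
theorem exists_chebyshevS_sum_eq_mul [Nontrivial R] (m : ℕ) (hm : 1 ≤ m) :
    ∃ f g : R[X], f.Monic ∧ g.Monic ∧ f.natDegree = m / 2 ∧ f ∣ S R m ∧ g ∣ S R (m - 1) ∧
      ∑ j ∈ Finset.range m, S R (j : ℤ) = f * g := by
  have hdeg (k : ℕ) : (S R k).natDegree = k :=
    natDegree_eq_of_degree_eq_some (chebyshevS_monic_degree R k).2.1
  obtain ⟨k, rfl | rfl⟩ : ∃ k, m = 2 * (k + 1) ∨ m = 2 * k + 1 := ⟨(m - 1) / 2, by omega⟩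
  · obtain ⟨hmon, hd⟩ := chebyshevS_add_monic_natDegree R (k + 1)
    refine ⟨_, S R k, hmon, (chebyshevS_monic_degree R k).1, by rw [hd]; omega, ?_, ?_, ?_⟩
    · have := (chebyshevS_double R (k + 1)).1
      exact ⟨_, by push_cast at this ⊢; exact this⟩
    · refine ⟨_, Eq.trans ?_ (chebyshevS_double R k).2⟩
      congr 1; push_cast; ring
    · rw [(chebyshevS_sum R (k + 1)).1, mul_comm]
      congr 2
      push_cast; ring
  · refine ⟨S R k, _, (chebyshevS_monic_degree R k).1, (chebyshevS_add_monic_natDegree R k).1,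
      by rw [hdeg]; omega, ?_, ?_, (chebyshevS_sum R k).2⟩
    · exact ⟨_, by push_cast; exact (chebyshevS_double R k).2⟩
    · refine ⟨_, Eq.trans ?_ (chebyshevS_double R k).1⟩
      congr 1; push_cast; ring

end ChebyshevIdentities

section PathMatrix

variable (R : Type*) [CommRing R]

/-- The adjacency matrix of the path on `m` vertices, over an arbitrary ring. -/
def pathMatrix (m : ℕ) : Matrix (Fin m) (Fin m) R :=
  Matrix.of fun i j => if (i : ℕ) + 1 = (j : ℕ) ∨ (j : ℕ) + 1 = (i : ℕ) then 1 else 0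

/-- The diagonal matrix `diag(1,0,…,0)`, over an arbitrary ring. -/
def rootMatrix (m : ℕ) : Matrix (Fin m) (Fin m) R :=
  Matrix.of fun i j => if i = j ∧ (i : ℕ) = 0 then 1 else 0

variable {R}

theorem pathMatrix_mulVec (m : ℕ) (w : ℤ → R) (i : Fin m) :
    (pathMatrix R m *ᵥ fun j => w (j : ℕ)) i =
      (if (i : ℕ) + 1 < m then w (i + 1) else 0) + if 0 < (i : ℕ) then w (i - 1) else 0 := by
  have h : ∀ j : Fin m, pathMatrix R m i j * w (j : ℕ) =
      (if (i : ℕ) + 1 = j then w ((j : ℕ) : ℤ) else 0) +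
        if (i : ℕ) = (j : ℕ) + 1 then w ((j : ℕ) : ℤ) else 0 := by
    intro j
    simp only [pathMatrix, of_apply]
    split_ifs <;> first | omega | simp
  simp only [mulVec, dotProduct, h, Finset.sum_add_distrib]
  congr 1
  · rw [Fin.sum_univ_eq_sum_range (fun j => if (i : ℕ) + 1 = j then w ((j : ℕ) : ℤ) else 0) m]
    simp
  · rw [Fin.sum_univ_eq_sum_range (fun j => if (i : ℕ) = j + 1 then w ((j : ℕ) : ℤ) else 0) m]
    obtain ⟨i, hi⟩ := i
    rcases i with _ | i
    · simp
    · simp [Nat.lt_of_succ_lt hi]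

theorem rootMatrix_mulVec (m : ℕ) (w : Fin m → R) (i : Fin m) :
    (rootMatrix R m *ᵥ w) i = if (i : ℕ) = 0 then w i else 0 := by
  simp only [mulVec, dotProduct, rootMatrix, of_apply, ite_mul, one_mul, zero_mul, ite_and]
  simp

theorem det_sub_looped_path_sq (k : ℕ) (x t : R) :
    (x • (1 : Matrix (Fin (k + 1)) (Fin (k + 1)) R) -
        (pathMatrix R (k + 1) + t • rootMatrix R (k + 1))).det ^ 2 =
      ((Chebyshev.S R (k + 1)).eval x - t * (Chebyshev.S R k).eval x) ^ 2 := by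
  set M := x • (1 : Matrix (Fin (k + 1)) (Fin (k + 1)) R) -
    (pathMatrix R (k + 1) + t • rootMatrix R (k + 1)) with hM
  set c := (Chebyshev.S R (k + 1)).eval x - t * (Chebyshev.S R k).eval x with hc
  set w : Fin (k + 1) → R := fun i => (Chebyshev.S R (k - ((i : ℕ) : ℤ))).eval x with hw
  have hMw : M *ᵥ w = c • Pi.single 0 1 := by
    ext i
    have hp := pathMatrix_mulVec (k + 1) (fun i => (Chebyshev.S R (k - i)).eval x) i
    simp only [hM, sub_mulVec, add_mulVec, smul_mulVec, one_mulVec, Pi.sub_apply, Pi.add_apply,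
      Pi.smul_apply, rootMatrix_mulVec, smul_eq_mul]
    rw [hw, hp]
    have hrec := congrArg (eval x) (Chebyshev.S_add_one R (k - ((i : ℕ) : ℤ)))
    simp only [eval_sub, eval_mul, eval_X] at hrec
    have hlast : ¬ (i : ℕ) + 1 < k + 1 → (Chebyshev.S R (k - ((i : ℕ) : ℤ) - 1)).eval x = 0 := by
      intro h
      have : ((i : ℕ) : ℤ) = k := by omega
      simp [this]
    rw [show (k : ℤ) - (((i : ℕ) : ℤ) + 1) = k - ((i : ℕ) : ℤ) - 1 by ring,
      show (k : ℤ) - (((i : ℕ) : ℤ) - 1) = k - ((i : ℕ) : ℤ) + 1 by ring]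
    have hsimp : (if (i : ℕ) + 1 < k + 1 then (Chebyshev.S R (k - ((i : ℕ) : ℤ) - 1)).eval x else 0)
        = (Chebyshev.S R (k - ((i : ℕ) : ℤ) - 1)).eval x := by
      split_ifs with h
      · rfl
      · exact (hlast h).symm
    rw [hsimp]
    by_cases hi : i = 0
    · subst hi
      simp at hrec ⊢
      rw [hc, hrec]
      ring
    · have hi' : (i : ℕ) ≠ 0 := fun h => hi (Fin.ext h)
      simp [hi, hi', Nat.pos_of_ne_zero hi', hrec]
  have hadj := congrArg (fun v => (M.adjugate *ᵥ v) (Fin.last k)) hMw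
  simp only [mulVec_mulVec, adjugate_mul, smul_mulVec, one_mulVec, mulVec_smul, Pi.smul_apply,
    mulVec_single_one, smul_eq_mul, col_apply] at hadj
  have hwl : w (Fin.last k) = 1 := by simp [hw]
  rw [hwl, mul_one, adjugate_fin_succ_eq_det_submatrix] at hadj
  have hentry (i j : Fin k) : M i.succ j.castSucc = x * (if (i : ℕ) + 1 = j then 1 else 0) -
      ((if (i : ℕ) + 1 + 1 = j ∨ (j : ℕ) + 1 = i + 1 then 1 else 0) +
        t * if (i : ℕ) + 1 = j ∧ (i : ℕ) + 1 = 0 then 1 else 0) := by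
    simp only [hM, pathMatrix, rootMatrix, Matrix.sub_apply, Matrix.add_apply, Matrix.smul_apply,
      one_apply, of_apply, Fin.ext_iff, Fin.val_succ, Fin.val_castSucc, smul_eq_mul]
  have htri : (M.submatrix (Fin.succAbove 0) (Fin.last k).succAbove).det = (-1) ^ k := by
    rw [det_of_isUpperTriangular]
    · simp [hentry]
    · intro i j hij
      have hij' : (j : ℕ) < i := hij
      simp only [submatrix_apply, Fin.succAbove_zero, Fin.succAbove_last, hentry]
      split_ifs <;> first | omega | simp
  rw [htri] at hadj
  rw [hadj, mul_pow, mul_pow, ← pow_mul, ← pow_mul]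
  simp

end PathMatrix

section RootedProduct

variable {R : Type*} [CommRing R] {ι : Type*} [DecidableEq ι]

/-- The adjacency matrix `A(P_m) ⊗ I + D₁ ⊗ A` of the rooted product, over an arbitrary ring. -/
def rootedProduct (m : ℕ) (A : Matrix ι ι R) : Matrix (Fin m × ι) (Fin m × ι) R :=
  pathMatrix R m ⊗ₖ (1 : Matrix ι ι R) + rootMatrix R m ⊗ₖ A

theorem rootedProduct_map {R' : Type*} [CommRing R'] (φ : R →+* R') (m : ℕ) (A : Matrix ι ι R) :
    (rootedProduct m A).map φ = rootedProduct m (A.map φ) := by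
  ext p q
  simp [rootedProduct, pathMatrix, rootMatrix, one_apply, apply_ite φ]

variable [Fintype ι]

theorem det_sub_rootedProduct_sq (k : ℕ) (A : Matrix ι ι R) (x : R) :
    (x • (1 : Matrix (Fin (k + 1) × ι) (Fin (k + 1) × ι) R) - rootedProduct (k + 1) A).det ^ 2 =
      ((Chebyshev.S R (k + 1)).eval x • (1 : Matrix ι ι R) -
        (Chebyshev.S R k).eval x • A).det ^ 2 := by
  set M : Matrix (Fin (k + 1)) (Fin (k + 1)) R[X] :=
    C x • 1 - (pathMatrix R[X] (k + 1) + (X : R[X]) • rootMatrix R[X] (k + 1)) with hM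
  have hS (j : ℤ) : (Chebyshev.S R[X] j).eval (C x) = C ((Chebyshev.S R j).eval x) :=
    (Chebyshev.algebraMap_eval_S (R' := R[X]) x j).symm
  have hcomp : x • (1 : Matrix (Fin (k + 1) × ι) (Fin (k + 1) × ι) R) - rootedProduct (k + 1) A =
      (M.map (aeval A : R[X] →ₐ[R] Matrix ι ι R).toRingHom).comp _ _ _ _ R := by
    ext ⟨i, r⟩ ⟨j, s⟩
    simp only [hM, rootedProduct, pathMatrix, rootMatrix, Matrix.sub_apply, Matrix.add_apply,
      Matrix.smul_apply, one_apply, of_apply, smul_eq_mul, kroneckerMap_apply, comp_apply,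
      Matrix.map_apply, Prod.mk.injEq, AlgHom.toRingHom_eq_coe, RingHom.coe_coe, map_sub, map_add,
      map_mul, aeval_C, aeval_X, apply_ite (aeval A), map_one, map_zero,
      Algebra.algebraMap_eq_smul_one]
    split_ifs <;> simp_all [one_apply]
  have hdet := congrArg (aeval A) (det_sub_looped_path_sq k (C x) (X : R[X]))
  rw [← hM, hS, hS] at hdet
  have hdet' := congrArg Matrix.det hdet
  simp only [map_pow, map_sub, map_mul, aeval_C, aeval_X, det_pow] at hdet'
  rw [hcomp, ← det_det, AlgHom.toRingHom_eq_coe, RingHom.coe_coe, hdet',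
    Algebra.algebraMap_eq_smul_one, Algebra.algebraMap_eq_smul_one, mul_smul_comm, mul_one]

theorem det_aeval_sq_of_roots {K κ : Type*} [Field K] [IsAlgClosed K] [Fintype κ] [DecidableEq κ]
    (N : Matrix κ κ K) (f : K[X]) (hf : f.Monic) (d : K)
    (h : ∀ x, f.IsRoot x → (x • (1 : Matrix κ κ K) - N).det ^ 2 = d ^ 2) :
    (aeval N f).det ^ 2 = (d ^ f.natDegree) ^ 2 := by
  have key : ∀ s : Multiset K, (∀ x ∈ s, (x • (1 : Matrix κ κ K) - N).det ^ 2 = d ^ 2) →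
      (aeval N (s.map (X - C ·)).prod).det ^ 2 = (d ^ s.card) ^ 2 := by
    intro s
    induction s using Multiset.induction_on with
    | empty => simp
    | cons x s ih =>
      intro hs
      have hx := hs x (Multiset.mem_cons_self x s)
      have ih' := ih fun y hy => hs y (Multiset.mem_cons_of_mem hy)
      have hneg : aeval N (X - C x) = -(x • (1 : Matrix κ κ K) - N) := by
        simp [Algebra.algebraMap_eq_smul_one]
      rw [Multiset.map_cons, Multiset.prod_cons, map_mul, det_mul, mul_pow, ih',
        Multiset.card_cons, hneg, det_neg, mul_pow, hx, ← pow_mul, mul_comm _ 2, pow_mul]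
      ring
  have hs := IsAlgClosed.splits f
  rw [hs.natDegree_eq_card_roots]
  conv_lhs => rw [hs.eq_prod_roots_of_monic hf]
  exact key _ fun x hx => h x (isRoot_of_mem_roots hx)

theorem det_aeval_rootedProduct_sq_of_dvd {K : Type*} [Field K] [IsAlgClosed K] (k : ℕ)
    (A : Matrix ι ι K) (f : K[X]) (hf : f.Monic) (hdvd : f ∣ Chebyshev.S K (k + 1)) :
    (aeval (rootedProduct (k + 1) A) f).det ^ 2 = (A.det ^ f.natDegree) ^ 2 := by
  refine det_aeval_sq_of_roots _ f hf _ fun x hx => ?_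
  have h₁ : (Chebyshev.S K (k + 1)).eval x = 0 := hx.dvd hdvd
  have h₂ := congrArg (eval x) (Chebyshev.S_sq_add_S_sq K k)
  simp only [eval_sub, eval_add, eval_pow, eval_mul, h₁, eval_one] at h₂
  have h₃ : (Chebyshev.S K k).eval x ^ 2 = 1 := by linear_combination h₂
  rw [det_sub_rootedProduct_sq, h₁, zero_smul, zero_sub, ← neg_smul, det_smul, mul_pow, ← pow_mul,
    mul_comm _ 2, pow_mul, neg_sq, h₃, one_pow, one_mul]

theorem det_aeval_rootedProduct_sq_of_dvd_pred {K : Type*} [Field K] [IsAlgClosed K] (k : ℕ)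
    (A : Matrix ι ι K) (f : K[X]) (hf : f.Monic) (hdvd : f ∣ Chebyshev.S K k) :
    (aeval (rootedProduct (k + 1) A) f).det ^ 2 = 1 := by
  rw [det_aeval_sq_of_roots _ f hf 1, one_pow, one_pow]
  intro x hx
  have h₁ : (Chebyshev.S K k).eval x = 0 := hx.dvd hdvd
  have h₂ := congrArg (eval x) (Chebyshev.S_sq_add_S_sq K k)
  simp only [eval_sub, eval_add, eval_pow, eval_mul, h₁, eval_one] at h₂
  have h₃ : (Chebyshev.S K (k + 1)).eval x ^ 2 = 1 := by linear_combination h₂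
  rw [det_sub_rootedProduct_sq, h₁, zero_smul, sub_zero, det_smul, mul_pow, ← pow_mul,
    mul_comm _ 2, pow_mul, h₃, one_pow, det_one, one_pow, one_mul]

theorem cast_det_aeval_rootedProduct {K : Type*} [Field K] (m : ℕ) (A : Matrix ι ι ℤ) (f : ℤ[X]) :
    (((aeval (rootedProduct m A) f).det : ℤ) : K) =
      (aeval (rootedProduct m (A.map (Int.castRingHom K))) (f.map (Int.castRingHom K))).det := by
  rw [← rootedProduct_map, ← eq_intCast (Int.castRingHom K), RingHom.map_det]
  congr 1
  rw [← algebraMap_int_eq, aeval_map_algebraMap, ← RingHom.mapMatrix_apply]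
  exact (aeval_algHom_apply (algebraMap ℤ K).toIntAlgHom.mapMatrix (rootedProduct m A) f).symm

theorem det_aeval_rootedProduct_int_sq_of_dvd (k : ℕ) (A : Matrix ι ι ℤ) (f : ℤ[X])
    (hf : f.Monic) (hdvd : f ∣ Chebyshev.S ℤ (k + 1)) :
    (aeval (rootedProduct (k + 1) A) f).det ^ 2 = (A.det ^ f.natDegree) ^ 2 := by
  have h := det_aeval_rootedProduct_sq_of_dvd k (A.map (Int.castRingHom ℂ)) _
    (hf.map (Int.castRingHom ℂ)) (by
      simpa only [Chebyshev.map_S] using Polynomial.map_dvd (Int.castRingHom ℂ) hdvd)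
  rw [← cast_det_aeval_rootedProduct, hf.natDegree_map, ← RingHom.mapMatrix_apply,
    ← RingHom.map_det, eq_intCast] at h
  exact_mod_cast h

theorem det_aeval_rootedProduct_int_sq_of_dvd_pred (k : ℕ) (A : Matrix ι ι ℤ) (f : ℤ[X])
    (hf : f.Monic) (hdvd : f ∣ Chebyshev.S ℤ k) :
    (aeval (rootedProduct (k + 1) A) f).det ^ 2 = 1 := by
  have h := det_aeval_rootedProduct_sq_of_dvd_pred k (A.map (Int.castRingHom ℂ)) _
    (hf.map (Int.castRingHom ℂ)) (by
      simpa only [Chebyshev.map_S] using Polynomial.map_dvd (Int.castRingHom ℂ) hdvd)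
  rw [← cast_det_aeval_rootedProduct] at h
  exact_mod_cast h

end RootedProduct

section Krylov

variable {R : Type*} [CommRing R] {κ : Type*} [Fintype κ] [DecidableEq κ] {N : ℕ}

/-- The matrix `[v, Mv, …, M^{N-1}v]`, with its columns indexed through `e : κ ≃ Fin N`. -/
def krylovMatrix (M : Matrix κ κ R) (v : κ → R) (e : κ ≃ Fin N) : Matrix κ κ R :=
  Matrix.of fun p q => (M ^ (e q : ℕ) *ᵥ v) p

theorem exists_aeval_mulVec_eq_krylovMatrix_mulVec (M : Matrix κ κ R) (v : κ → R) (e : κ ≃ Fin N)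
    (g : R[X]) : ∃ c, aeval M g *ᵥ v = krylovMatrix M v e *ᵥ c := by
  nontriviality R
  have hmod : aeval M g = aeval M (g %ₘ M.charpoly) := by
    conv_lhs => rw [← modByMonic_add_div g M.charpoly]
    simp [aeval_self_charpoly]
  have hdeg : (g %ₘ M.charpoly).degree < N := by
    refine (degree_modByMonic_lt _ M.charpoly_monic).trans_eq ?_
    rw [charpoly_degree_eq_dim, Fintype.card_congr e, Fintype.card_fin]
  refine ⟨fun q => (g %ₘ M.charpoly).coeff (e q), ?_⟩
  rw [hmod]
  ext p
  by_cases h0 : g %ₘ M.charpoly = 0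
  · simp [h0, mulVec, dotProduct]
  rw [aeval_eq_sum_range' ((natDegree_lt_iff_degree_lt h0).2 hdeg), sum_mulVec, Finset.sum_apply,
    ← Fin.sum_univ_eq_sum_range
      (fun i => (((g %ₘ M.charpoly).coeff i • M ^ i) *ᵥ v) p), ← e.sum_comp]
  simp only [mulVec, dotProduct, krylovMatrix, of_apply, smul_eq_mul, Matrix.smul_apply,
    mul_assoc, Finset.mul_sum, mul_comm]

theorem krylovMatrix_aeval_mulVec (M : Matrix κ κ R) (v : κ → R) (e : κ ≃ Fin N) (g : R[X]) :
    krylovMatrix M (aeval M g *ᵥ v) e = aeval M g * krylovMatrix M v e := by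
  ext p q
  have hc : M ^ (e q : ℕ) * aeval M g = aeval M g * M ^ (e q : ℕ) := by
    rw [← aeval_X_pow (R := R) M, ← map_mul, mul_comm, map_mul]
  simp only [krylovMatrix, of_apply, mulVec_mulVec, hc, mul_apply]
  rw [← mulVec_mulVec]
  rfl

theorem det_dvd_det_of_col_mem_range (K D : Matrix κ κ R) (h : ∀ q, ∃ c, D.col q = K *ᵥ c) :
    K.det ∣ D.det := by
  choose c hc using h
  have hD : D = K * (Matrix.of c)ᵀ := by
    ext p q
    exact congrFun (hc q) p
  exact ⟨_, by conv_lhs => rw [hD, det_mul]⟩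

theorem exists_aeval_mul_aeval_eq_one (M : Matrix κ κ R) (g : R[X])
    (h : IsUnit (aeval M g).det) : ∃ r : R[X], aeval M r * aeval M g = 1 := by
  set P := aeval M g with hP
  have hu : IsUnit (P.charpoly.coeff 0) := by
    rw [det_eq_sign_charpoly_coeff] at h
    exact isUnit_of_mul_isUnit_right h
  obtain ⟨u, hu⟩ := hu
  have hCH := aeval_self_charpoly P
  rw [← divX_mul_X_add P.charpoly, map_add, map_mul, aeval_X, aeval_C, ← hu,
    Algebra.algebraMap_eq_smul_one] at hCH
  refine ⟨C (-(↑u⁻¹ : R)) * P.charpoly.divX.comp g, ?_⟩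
  rw [map_mul, aeval_C, aeval_comp, ← hP, Algebra.algebraMap_eq_smul_one, mul_assoc, smul_mul_assoc,
    one_mul, eq_neg_of_add_eq_zero_left hCH, neg_smul, smul_neg, neg_neg, smul_smul, Units.inv_mul,
    one_smul]

end Krylov

section RootedProductKrylov

theorem kronecker_mulVec_mul {R ι κ : Type*} [CommRing R] [Fintype ι] [Fintype κ]
    (P : Matrix κ κ R) (Q : Matrix ι ι R) (y : κ → R) (u : ι → R) :
    (P ⊗ₖ Q) *ᵥ (fun p => y p.1 * u p.2) = fun p => (P *ᵥ y) p.1 * (Q *ᵥ u) p.2 := by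
  ext p
  simp only [mulVec, dotProduct, kroneckerMap_apply, Fintype.sum_prod_type, Finset.sum_mul_sum]
  exact Finset.sum_congr rfl fun i _ => Finset.sum_congr rfl fun j _ => by ring

variable {R : Type*} [CommRing R] {ι : Type*}

/-- The vector on the rooted product with `m`-vertex paths that equals `u` on the copy of the graph
at distance `b` from the free ends of the paths, and vanishes elsewhere. -/
def layerVec (m : ℕ) (b : ℤ) (u : ι → R) : Fin m × ι → R :=
  fun p => if ((p.1 : ℕ) : ℤ) + b + 1 = m then u p.2 else 0

theorem sum_layerVec (m : ℕ) (u : ι → R) :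
    ∑ j ∈ Finset.range m, layerVec m (j : ℤ) u = fun p => u p.2 := by
  ext ⟨⟨i, hi⟩, r⟩
  simp only [Finset.sum_apply, layerVec]
  rw [Finset.sum_eq_single (m - 1 - i)]
  · exact if_pos (by omega)
  · intro j _ hj
    exact if_neg (by omega)
  · intro h
    simp at h
    omega

theorem layerVec_eq_kronecker_mulVec [Fintype ι] (m : ℕ) (b : ℤ) (W : Matrix ι ι R) (c : ι → R) :
    layerVec m b (W *ᵥ c) = ((1 : Matrix (Fin m) (Fin m) R) ⊗ₖ W) *ᵥ layerVec m b c := by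
  have hl (u : ι → R) : layerVec m b u =
      fun p => (if ((p.1 : ℕ) : ℤ) + b + 1 = m then (1 : R) else 0) * u p.2 := by
    ext p; simp [layerVec]
  rw [hl, hl, kronecker_mulVec_mul _ _
    (fun i : Fin m => if ((i : ℕ) : ℤ) + b + 1 = m then (1 : R) else 0), one_mulVec]

variable [Fintype ι] [DecidableEq ι]

theorem rootedProduct_mulVec_layerVec (m : ℕ) (A : Matrix ι ι R) (b : ℕ) (hb : b < m)
    (u : ι → R) : rootedProduct m A *ᵥ layerVec m b u =
      layerVec m (b + 1) u + layerVec m (b - 1) u +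
        if b + 1 = m then layerVec m b (A *ᵥ u) else 0 := by
  have hl : layerVec m b u =
      fun p => (if ((p.1 : ℕ) : ℤ) + b + 1 = m then (1 : R) else 0) * u p.2 := by
    ext p; simp [layerVec]
  rw [rootedProduct, add_mulVec, hl,
    kronecker_mulVec_mul _ _ (fun i : Fin m => if ((i : ℕ) : ℤ) + b + 1 = m then (1 : R) else 0),
    kronecker_mulVec_mul _ _ (fun i : Fin m => if ((i : ℕ) : ℤ) + b + 1 = m then (1 : R) else 0)]
  ext ⟨⟨i, hi⟩, r⟩
  simp only [Pi.add_apply, pathMatrix_mulVec m (fun i : ℤ => if i + b + 1 = m then (1 : R) else 0),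
    rootMatrix_mulVec, one_mulVec, layerVec]
  split_ifs <;> first | omega | simp [layerVec] <;> omega

theorem aeval_chebyshevS_mulVec_layerVec (m : ℕ) (A : Matrix ι ι R) (u : ι → R) (j : ℕ)
    (hj : j < m) :
    aeval (rootedProduct m A) (Chebyshev.S R j) *ᵥ layerVec m 0 u = layerVec m j u := by
  induction j using Nat.strong_induction_on with
  | _ j ih =>
    match j with
    | 0 => simp
    | 1 =>
      have h := rootedProduct_mulVec_layerVec m A 0 (by omega) u
      have h' : layerVec m (-1) u = 0 := by
        ext ⟨⟨i, hi⟩, r⟩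
        simp only [layerVec, Pi.zero_apply]
        exact if_neg (by omega)
      rw [if_neg (by omega)] at h
      simpa [h'] using h
    | j + 2 =>
      have h := rootedProduct_mulVec_layerVec m A (j + 1) (by omega) u
      rw [if_neg (by omega), add_zero] at h
      have h₁ := ih (j + 1) (by omega) (by omega)
      have h₀ := ih j (by omega) (by omega)
      push_cast at h h₁ ⊢
      rw [Chebyshev.S_add_two, map_sub, map_mul, aeval_X, sub_mulVec, ← mulVec_mulVec, h₁, h₀, h]
      simp [add_assoc]

theorem aeval_chebyshevS_self_mulVec_layerVec (k : ℕ) (A : Matrix ι ι R) (u : ι → R) :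
    aeval (rootedProduct (k + 1) A) (Chebyshev.S R (k + 1)) *ᵥ layerVec (k + 1) 0 u =
      layerVec (k + 1) k (A *ᵥ u) := by
  have h := rootedProduct_mulVec_layerVec (k + 1) A k (by omega) u
  have h₁ := aeval_chebyshevS_mulVec_layerVec (k + 1) A u k (by omega)
  have h₀ : aeval (rootedProduct (k + 1) A) (Chebyshev.S R (k - 1)) *ᵥ layerVec (k + 1) 0 u =
      layerVec (k + 1) (k - 1) u := by
    rcases k with _ | k
    · ext ⟨⟨i, hi⟩, r⟩
      simp only [layerVec]
      rw [if_neg (by omega)]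
      simp
    · simpa using aeval_chebyshevS_mulVec_layerVec (k + 1 + 1) A u k (by omega)
  have h₂ : layerVec (k + 1) (k + 1) u = 0 := by
    ext ⟨⟨i, hi⟩, r⟩
    simp only [layerVec, Pi.zero_apply]
    exact if_neg (by omega)
  rw [if_pos rfl, h₂, zero_add] at h
  rw [Chebyshev.S_add_one, map_sub, map_mul, aeval_X, sub_mulVec, ← mulVec_mulVec, h₁, h₀, h]
  simp

variable {n m : ℕ}

/-- Every Krylov vector of the rooted product is a combination of walk vectors in layers. -/
theorem det_one_kronecker_krylovMatrix_dvd (A : Matrix ι ι R) (v : ι → R) (e : ι ≃ Fin n)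
    (e' : Fin m × ι ≃ Fin N) (b : ℤ) :
    ((1 : Matrix (Fin m) (Fin m) R) ⊗ₖ krylovMatrix A v e).det ∣
      (krylovMatrix (rootedProduct m A) (layerVec m b v) e').det := by
  set W := krylovMatrix A v e with hW
  obtain ⟨c, hc⟩ := exists_aeval_mulVec_eq_krylovMatrix_mulVec A v e 1
  rw [map_one, one_mulVec, ← hW] at hc
  have hcol (q : ι) : ∃ c, (A * W).col q = W *ᵥ c := by
    obtain ⟨c, hc⟩ := exists_aeval_mulVec_eq_krylovMatrix_mulVec A v e (X ^ ((e q : ℕ) + 1))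
    refine ⟨c, ?_⟩
    rw [← hc, aeval_X_pow, pow_succ', ← mulVec_mulVec]
    rfl
  choose B hB using hcol
  have hAW : A * W = W * (Matrix.of B)ᵀ := by
    ext p q
    exact congrFun (hB q) p
  have hcomm : rootedProduct m A * ((1 : Matrix (Fin m) (Fin m) R) ⊗ₖ W) =
      ((1 : Matrix (Fin m) (Fin m) R) ⊗ₖ W) * rootedProduct m (Matrix.of B)ᵀ := by
    simp only [rootedProduct, add_mul, mul_add, ← mul_kronecker_mul, one_mul, mul_one, hAW]
  have hpow (k : ℕ) : rootedProduct m A ^ k * ((1 : Matrix (Fin m) (Fin m) R) ⊗ₖ W) =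
      ((1 : Matrix (Fin m) (Fin m) R) ⊗ₖ W) * rootedProduct m (Matrix.of B)ᵀ ^ k :=
    (SemiconjBy.pow_right (show SemiconjBy _ _ _ from hcomm.symm) k).symm
  refine det_dvd_det_of_col_mem_range _ _ fun q =>
    ⟨rootedProduct m (Matrix.of B)ᵀ ^ (e' q : ℕ) *ᵥ layerVec m b c, ?_⟩
  rw [mulVec_mulVec, ← hpow, ← mulVec_mulVec, ← layerVec_eq_kronecker_mulVec, ← hc]
  rfl

/-- Every walk vector in a layer is a combination of Krylov vectors of the rooted product. -/
theorem det_krylovMatrix_rootedProduct_dvd (k : ℕ) (A : Matrix ι ι R) (v : ι → R) (e : ι ≃ Fin n)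
    (e' : Fin (k + 1) × ι ≃ Fin N)
    (hunit : IsUnit (aeval (rootedProduct (k + 1) A) (Chebyshev.S R k)).det) :
    (krylovMatrix (rootedProduct (k + 1) A) (layerVec (k + 1) 0 v) e').det ∣
      ((1 : Matrix (Fin (k + 1)) (Fin (k + 1)) R) ⊗ₖ krylovMatrix A v e).det := by
  obtain ⟨r, hr⟩ := exists_aeval_mul_aeval_eq_one _ _ hunit
  have hshift (u : ι → R) : layerVec (k + 1) 0 (A *ᵥ u) =
      aeval (rootedProduct (k + 1) A) (r * Chebyshev.S R (k + 1)) *ᵥ layerVec (k + 1) 0 u := by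
    rw [map_mul, ← mulVec_mulVec, aeval_chebyshevS_self_mulVec_layerVec,
      ← aeval_chebyshevS_mulVec_layerVec (k + 1) A _ k (by omega), mulVec_mulVec, hr, one_mulVec]
  have hpow (j : ℕ) : layerVec (k + 1) 0 (A ^ j *ᵥ v) =
      aeval (rootedProduct (k + 1) A) ((r * Chebyshev.S R (k + 1)) ^ j) *ᵥ
        layerVec (k + 1) 0 v := by
    induction j with
    | zero => simp
    | succ j ih =>
      rw [pow_succ', ← mulVec_mulVec, hshift, ih, mulVec_mulVec, ← map_mul, ← pow_succ']
  refine det_dvd_det_of_col_mem_range _ _ fun q => ?_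
  obtain ⟨⟨i, hi⟩, s⟩ := q
  obtain ⟨c, hc⟩ := exists_aeval_mulVec_eq_krylovMatrix_mulVec (rootedProduct (k + 1) A)
    (layerVec (k + 1) 0 v) e'
    (Chebyshev.S R (k - i : ℕ) * (r * Chebyshev.S R (k + 1)) ^ (e s : ℕ))
  refine ⟨c, ?_⟩
  rw [← hc, map_mul, ← mulVec_mulVec, ← hpow, aeval_chebyshevS_mulVec_layerVec _ _ _ _ (by omega)]
  ext ⟨⟨j, hj⟩, t⟩
  simp only [col_apply, kroneckerMap_apply, one_apply, Fin.mk.injEq, krylovMatrix, of_apply,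
    layerVec, ite_mul, one_mul, zero_mul]
  exact if_congr (by omega) rfl rfl

theorem det_krylovMatrix_rootedProduct_int_sq (k : ℕ) (A : Matrix ι ι ℤ) (u : ι → ℤ)
    (e : ι ≃ Fin n) (e' : Fin (k + 1) × ι ≃ Fin N) :
    (krylovMatrix (rootedProduct (k + 1) A) (fun p => u p.2) e').det ^ 2 =
      (A.det ^ ((k + 1) / 2) * (krylovMatrix A u e).det ^ (k + 1)) ^ 2 := by
  have hunit : IsUnit (aeval (rootedProduct (k + 1) A) (Chebyshev.S ℤ k)).det :=
    IsUnit.of_pow_eq_one (det_aeval_rootedProduct_int_sq_of_dvd_pred k A _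
      (chebyshevS_monic_degree ℤ k).1 dvd_rfl) two_ne_zero
  have hK : (krylovMatrix (rootedProduct (k + 1) A) (layerVec (k + 1) 0 u) e').det ^ 2 =
      ((krylovMatrix A u e).det ^ (k + 1)) ^ 2 := by
    have h := Int.natAbs_eq_of_dvd_dvd (det_krylovMatrix_rootedProduct_dvd k A u e e' hunit)
      (det_one_kronecker_krylovMatrix_dvd A u e e' 0)
    rw [det_kronecker, det_one, one_pow, one_mul, Fintype.card_fin] at h
    exact Int.natAbs_eq_iff_sq_eq.1 h
  obtain ⟨f, g, hf, hg, hdeg, hfd, hgd, hsum⟩ :=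
    exists_chebyshevS_sum_eq_mul ℤ (k + 1) (by omega)
  have hvec : (fun p : Fin (k + 1) × ι => u p.2) =
      aeval (rootedProduct (k + 1) A) (f * g) *ᵥ layerVec (k + 1) 0 u := by
    rw [← hsum, map_sum, sum_mulVec, ← sum_layerVec]
    exact Finset.sum_congr rfl fun j hj =>
      (aeval_chebyshevS_mulVec_layerVec _ A u j (Finset.mem_range.1 hj)).symm
  push_cast at hfd hgd
  rw [add_sub_cancel_right] at hgd
  rw [hvec, krylovMatrix_aeval_mulVec, map_mul, det_mul, det_mul, mul_pow, mul_pow, hK,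
    det_aeval_rootedProduct_int_sq_of_dvd k A f hf hfd,
    det_aeval_rootedProduct_int_sq_of_dvd_pred k A g hg hgd, hdeg, mul_one, ← mul_pow]

end RootedProductKrylov

theorem walkMatrix_map {N : ℕ} (M : Matrix (Fin N) (Fin N) ℤ) :
    walkMatrix (M.map (Int.castRingHom ℝ)) =
      (krylovMatrix M (fun _ => 1) (Equiv.refl _)).map (Int.castRingHom ℝ) := by
  ext i j
  have h : M.map (Int.castRingHom ℝ) ^ (j : ℕ) = (M ^ (j : ℕ)).map (Int.castRingHom ℝ) :=
    (map_pow (Int.castRingHom ℝ).mapMatrix M j).symm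
  simp only [walkMatrix, krylovMatrix, of_apply, h, Matrix.map_apply, Equiv.refl_apply, mulVec,
    dotProduct, map_sum, mul_one]

theorem det_walkMatrix_map_reindex {κ : Type*} [Fintype κ] [DecidableEq κ] {N : ℕ}
    (M : Matrix κ κ ℤ) (e : κ ≃ Fin N) :
    (walkMatrix (reindex e e (M.map (Int.castRingHom ℝ)))).det =
      ((krylovMatrix M (fun _ => 1) e).det : ℤ) := by
  have h : krylovMatrix (reindex e e M) (fun _ => 1) (Equiv.refl _) =
      reindex e e (krylovMatrix M (fun _ => 1) e) := by
    ext i j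
    have hp : reindex e e M ^ (j : ℕ) = reindex e e (M ^ (j : ℕ)) :=
      (map_pow (reindexAlgEquiv ℤ ℤ e) M j).symm
    simp only [krylovMatrix, of_apply, Equiv.refl_apply, hp]
    simp only [of_apply, reindex_apply, submatrix_apply,
      Equiv.apply_symm_apply, mulVec, dotProduct, mul_one]
    exact e.symm.sum_comp (fun q => (M ^ (j : ℕ)) (e.symm i) q)
  have h' : reindex e e (M.map (Int.castRingHom ℝ)) =
      (reindex e e M).map (Int.castRingHom ℝ) := rfl
  rw [h', walkMatrix_map, h, ← RingHom.mapMatrix_apply, ← RingHom.map_det, det_reindex_self,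
    eq_intCast]

theorem walk_matrix_rooted_product {n : ℕ} (m : ℕ) (hm : 2 ≤ m)
    (A : Matrix (Fin n) (Fin n) ℝ) (hsym : A.IsSymm)
    (h01 : ∀ i j, A i j = 0 ∨ A i j = 1) (hdiag : ∀ i, A i i = 0)
    (Atil : Matrix (Fin (m * n)) (Fin (m * n)) ℝ)
    (hAtil : Atil = Matrix.reindex finProdFinEquiv finProdFinEquiv
      (pathAdj m ⊗ₖ (1 : Matrix (Fin n) (Fin n) ℝ) + D1 m ⊗ₖ A)) :
    ∃ ε : ℝ, (ε = 1 ∨ ε = -1) ∧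
      (walkMatrix Atil).det =
        ε * ((-1 : ℝ) ^ n * A.det) ^ (m / 2) * (walkMatrix A).det ^ m := by
  obtain ⟨k, rfl⟩ : ∃ k, m = k + 1 := ⟨m - 1, by omega⟩
  obtain ⟨B, rfl⟩ : ∃ B : Matrix (Fin n) (Fin n) ℤ, A = B.map (Int.castRingHom ℝ) := by
    choose B hB using fun i j => show ∃ b : ℤ, A i j = b from
      (h01 i j).elim (fun h => ⟨0, by simp [h]⟩) fun h => ⟨1, by simp [h]⟩
    exact ⟨Matrix.of B, by ext i j; simp [hB]⟩
  have hM : Atil = Matrix.reindex finProdFinEquiv finProdFinEquiv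
      ((rootedProduct (k + 1) B).map (Int.castRingHom ℝ)) := by
    rw [hAtil, rootedProduct_map]
    rfl
  have hB : (walkMatrix (B.map (Int.castRingHom ℝ))).det =
      ((krylovMatrix B (fun _ => 1) (Equiv.refl _)).det : ℤ) :=
    det_walkMatrix_map_reindex B (Equiv.refl _)
  have hdet : (B.map (Int.castRingHom ℝ)).det = (B.det : ℤ) := by
    rw [← RingHom.mapMatrix_apply, ← RingHom.map_det, eq_intCast]
  have hsq := congrArg (Int.cast (R := ℝ)) (det_krylovMatrix_rootedProduct_int_sq k B (fun _ => 1)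
    (Equiv.refl _) finProdFinEquiv)
  simp only [Int.cast_pow, Int.cast_mul] at hsq
  have hsq' : (walkMatrix Atil).det ^ 2 =
      (((-1 : ℝ) ^ n * (B.map (Int.castRingHom ℝ)).det) ^ ((k + 1) / 2) *
        (walkMatrix (B.map (Int.castRingHom ℝ))).det ^ (k + 1)) ^ 2 := by
    rw [hM, det_walkMatrix_map_reindex, hB, hdet, hsq, mul_pow ((-1 : ℝ) ^ n), mul_assoc,
      mul_pow (((-1 : ℝ) ^ n) ^ _)]
    simp [← pow_mul, mul_comm _ 2]
  rcases sq_eq_sq_iff_eq_or_eq_neg.1 hsq' with h | h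
  · exact ⟨1, Or.inl rfl, by rw [h]; ring⟩
  · exact ⟨-1, Or.inr rfl, by rw [h]; ring⟩
end

section
/- For every integer m ≥ 1 and every real number λ, the real polynomial S_m(x) − λ·S_{m−1}(x), which has degree m, has m distinct real roots; i.e., all of its roots are real and simple. -/
open Polynomial

/-- The renormalized Chebyshev polynomial of the second kind, `S k x = U k (x/2)`. -/
noncomputable def chebS (k : ℤ) : Polynomial ℝ :=
  (Polynomial.Chebyshev.U ℝ k).comp (Polynomial.C 2⁻¹ * Polynomial.X)

theorem chebS_eq_S (k : ℤ) : chebS k = Chebyshev.S ℝ k := by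
  have : Invertible (2 : ℝ) := invertibleOfNonzero two_ne_zero
  rw [Chebyshev.S_eq_U_comp_half_mul_X, chebS, invOf_eq_inv]

theorem natDegree_and_monic_S (n : ℕ) :
    (Chebyshev.S ℝ n).natDegree = n ∧ (Chebyshev.S ℝ n).Monic := by
  induction n using Nat.twoStepInduction with
  | zero => simp
  | one => simp [monic_X]
  | more n ih₀ ih₁ =>
    have hrec : Chebyshev.S ℝ ((n + 2 : ℕ) : ℤ) =
        X * Chebyshev.S ℝ ((n + 1 : ℕ) : ℤ) - Chebyshev.S ℝ (n : ℤ) := by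
      push_cast
      exact Chebyshev.S_add_two ℝ n
    have hX : (X * Chebyshev.S ℝ ((n + 1 : ℕ) : ℤ)).Monic := monic_X.mul ih₁.2
    have hXdeg : (X * Chebyshev.S ℝ ((n + 1 : ℕ) : ℤ)).natDegree = n + 2 := by
      rw [monic_X.natDegree_mul ih₁.2, ih₁.1, natDegree_X]
      ring
    have hlt : (Chebyshev.S ℝ (n : ℤ)).natDegree <
        (X * Chebyshev.S ℝ ((n + 1 : ℕ) : ℤ)).natDegree := by
      rw [ih₀.1, hXdeg]
      omega
    rw [hrec]
    exact ⟨(natDegree_sub_eq_left_of_natDegree_lt hlt).trans hXdeg,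
      hX.sub_of_left (degree_lt_degree hlt)⟩

theorem natDegree_and_monic_S_sub_C_mul_S (n : ℕ) (c : ℝ) :
    (Chebyshev.S ℝ (n + 1) - C c * Chebyshev.S ℝ n).natDegree = n + 1 ∧
    (Chebyshev.S ℝ (n + 1) - C c * Chebyshev.S ℝ n).Monic := by
  have h := natDegree_and_monic_S (n + 1)
  push_cast at h
  have hlt : (C c * Chebyshev.S ℝ n).natDegree < (Chebyshev.S ℝ (n + 1)).natDegree := by
    rw [h.1]
    have := natDegree_C_mul_le c (Chebyshev.S ℝ n)
    rw [(natDegree_and_monic_S n).1] at this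
    omega
  exact ⟨(natDegree_sub_eq_left_of_natDegree_lt hlt).trans h.1,
    h.2.sub_of_left (degree_lt_degree hlt)⟩

/-- At the extremal nodes `2 cos (jπ/(n+1))` the polynomial `S (n+1) - c S n` takes the
value `(-1) ^ j`. -/
theorem eval_S_sub_C_mul_S_node {n j : ℕ} (hj : 0 < j) (hjn : j < n + 1) (c : ℝ) :
    (Chebyshev.S ℝ (n + 1) - C c * Chebyshev.S ℝ n).eval
      (2 * Real.cos (j * Real.pi / (n + 1))) = (-1) ^ j := by
  set θ : ℝ := j * Real.pi / (n + 1) with hθ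
  have hn : (0 : ℝ) < n + 1 := by positivity
  have hj' : (0 : ℝ) < j := by exact_mod_cast hj
  have hjn' : (j : ℝ) < n + 1 := by exact_mod_cast hjn
  have hθ_mul : (n + 1) * θ = j * Real.pi := by rw [hθ]; field_simp
  have hsin : 0 < Real.sin θ := by
    refine Real.sin_pos_of_pos_of_lt_pi (by positivity) ?_
    rw [hθ, div_lt_iff₀ hn]
    nlinarith [Real.pi_pos]
  have h₁ := Chebyshev.S_two_mul_real_cos θ (n + 1 : ℤ)
  have h₀ := Chebyshev.S_two_mul_real_cos θ (n : ℤ)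
  push_cast at h₀ h₁
  rw [add_mul, one_mul, hθ_mul, Real.sin_add, Real.sin_nat_mul_pi, Real.cos_nat_mul_pi,
    zero_mul, zero_add] at h₁
  rw [hθ_mul, Real.sin_nat_mul_pi] at h₀
  have h₁' := mul_right_cancel₀ hsin.ne' h₁
  have h₀' := (mul_eq_zero.mp h₀).resolve_right hsin.ne'
  simp [h₁', h₀']

theorem Polynomial.Monic.exists_gt_eval_pos {p : ℝ[X]} (hp : p.Monic) (hdeg : 0 < p.natDegree)
    (a : ℝ) : ∃ x, a < x ∧ 0 < p.eval x := by
  have ht := p.tendsto_atTop_of_leadingCoeff_nonneg (natDegree_pos_iff_degree_pos.mp hdeg)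
    (by rw [hp.leadingCoeff]; exact zero_le_one)
  exact ((Filter.eventually_gt_atTop a).and (ht.eventually_gt_atTop 0)).exists

theorem Polynomial.Monic.exists_lt_eval_pos {p : ℝ[X]} (hp : p.Monic) (hdeg : 0 < p.natDegree)
    (a : ℝ) : ∃ x, x < a ∧ 0 < (-1) ^ p.natDegree * p.eval x := by
  have hq := hp.neg_one_pow_natDegree_mul_comp_neg_X
  have hqdeg : 0 < ((-1) ^ p.natDegree * p.comp (-X)).natDegree := by
    rcases neg_one_pow_eq_or ℝ[X] p.natDegree with h | h <;> simpa [h, natDegree_comp] using hdeg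
  obtain ⟨x, hx, hpos⟩ := hq.exists_gt_eval_pos hqdeg (-a)
  exact ⟨-x, by linarith, by simpa using hpos⟩

/-- A real polynomial of degree `m` alternating in sign along `m + 1` decreasing points has
`m` distinct real roots. -/
theorem Polynomial.card_roots_and_nodup_of_alternating {p : ℝ[X]} (x : ℕ → ℝ)
    (hx : ∀ j < p.natDegree, x (j + 1) < x j)
    (hsign : ∀ j ≤ p.natDegree, 0 < (-1) ^ j * p.eval (x j)) :
    p.roots.card = p.natDegree ∧ p.roots.Nodup := by
  have hp : p ≠ 0 := by
    rintro rfl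
    simpa using hsign 0 (Nat.zero_le _)
  have hroot : ∀ j : Fin p.natDegree, ∃ r ∈ Set.Ioo (x (j + 1)) (x j), p.eval r = 0 := by
    intro j
    have h₀ := hsign j j.2.le
    have h₁ := hsign (j + 1) j.2
    have hcont : ContinuousOn (fun t => (-1 : ℝ) ^ (j : ℕ) * p.eval t)
        (Set.Icc (x (j + 1)) (x j)) := by fun_prop
    obtain ⟨r, hr, h⟩ := intermediate_value_Ioo (hx j j.2).le hcont
      (show (0 : ℝ) ∈ Set.Ioo _ _ from ⟨by rw [pow_succ] at h₁; linarith, h₀⟩)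
    exact ⟨r, hr, (mul_eq_zero.mp h).resolve_left (pow_ne_zero _ (by norm_num))⟩
  choose r hr hr₀ using hroot
  have hanti : AntitoneOn x (Set.Iic p.natDegree) :=
    antitoneOn_of_succ_le Set.ordConnected_Iic fun j _ _ hj => (hx j hj).le
  have hr_anti : StrictAnti r := fun i j hij =>
    (hr j).2.trans_le ((hanti (Set.mem_Iic.mpr i.2) (Set.mem_Iic.mpr j.2.le) hij).trans
      (hr i).1.le)
  have hcard : p.natDegree ≤ p.roots.toFinset.card := by
    simpa using Finset.card_le_card_of_injOn (s := Finset.univ) r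
      (fun j _ => by simpa [hp] using hr₀ j) hr_anti.injective.injOn
  have hle := p.roots.toFinset_card_le
  have hdeg := p.card_roots'
  exact ⟨by omega, Multiset.toFinset_card_eq_card_iff_nodup.mp (by omega)⟩

theorem card_roots_and_nodup_S_sub_C_mul_S (n : ℕ) (c : ℝ) :
    (Chebyshev.S ℝ (n + 1) - C c * Chebyshev.S ℝ n).roots.card = n + 1 ∧
    (Chebyshev.S ℝ (n + 1) - C c * Chebyshev.S ℝ n).roots.Nodup := by
  obtain ⟨hdeg, hmonic⟩ := natDegree_and_monic_S_sub_C_mul_S n c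
  have hnode := fun j (h : 0 < j) (h' : j < n + 1) => eval_S_sub_C_mul_S_node h h' c
  generalize Chebyshev.S ℝ (n + 1) - C c * Chebyshev.S ℝ n = p at *
  obtain ⟨a, ha, hpa⟩ := hmonic.exists_gt_eval_pos (by omega) 2
  obtain ⟨b, hb, hpb⟩ := hmonic.exists_lt_eval_pos (by omega) (-2)
  let x : ℕ → ℝ := fun j =>
    if j = 0 then a else if j = n + 1 then b else 2 * Real.cos (j * Real.pi / (n + 1))
  rw [← hdeg]
  refine card_roots_and_nodup_of_alternating x (fun j hj => ?_) (fun j hj => ?_)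
  · rw [hdeg] at hj
    have hx₁ : j = n ∨ x (j + 1) = 2 * Real.cos ((j + 1 : ℕ) * Real.pi / (n + 1)) := by
      by_cases h : j = n <;> simp [x, h]
    have hlast : x (n + 1) = b := by simp [x]
    by_cases h₀ : j = 0
    · have : x j = a := by simp [x, h₀]
      rcases hx₁ with rfl | h
      · linarith
      · rw [h]
        linarith [Real.cos_le_one ((j + 1 : ℕ) * Real.pi / (n + 1))]
    · have hxj : x j = 2 * Real.cos (j * Real.pi / (n + 1)) := by
        simp [x, h₀, hj.ne]
      rcases hx₁ with rfl | h
      · linarith [Real.neg_one_le_cos (j * Real.pi / (j + 1))]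
      · rw [h, hxj]
        have hn : (0 : ℝ) < n + 1 := by positivity
        have hj' : ((j + 1 : ℕ) : ℝ) ≤ n + 1 := by exact_mod_cast hj
        refine mul_lt_mul_of_pos_left (Real.cos_lt_cos_of_nonneg_of_le_pi (by positivity) ?_ ?_)
          two_pos
        · rw [div_le_iff₀ hn]
          nlinarith [Real.pi_pos]
        · push_cast
          gcongr
          linarith
  · rw [hdeg] at hj
    by_cases h₀ : j = 0
    · simpa [x, h₀] using hpa
    · by_cases h₁ : j = n + 1
      · simpa [x, h₁, hdeg] using hpb
      · have hxj : x j = 2 * Real.cos (j * Real.pi / (n + 1)) := by simp [x, h₀, h₁]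
        rw [hxj, hnode j (by omega) (by omega), ← mul_pow]
        norm_num

theorem roots_real_simple (m : ℕ) (hm : 1 ≤ m) (lam : ℝ) :
    (chebS m - C lam * chebS ((m : ℤ) - 1)).natDegree = m ∧
    (chebS m - C lam * chebS ((m : ℤ) - 1)).roots.card = m ∧
    (chebS m - C lam * chebS ((m : ℤ) - 1)).roots.Nodup := by
  obtain ⟨n, rfl⟩ := Nat.exists_eq_add_of_le' hm
  rw [chebS_eq_S, chebS_eq_S]
  push_cast
  rw [add_sub_cancel_right]
  exact ⟨(natDegree_and_monic_S_sub_C_mul_S n lam).1, card_roots_and_nodup_S_sub_C_mul_S n lam⟩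
end

section
/- Let A be a real n×n matrix, λ a real number, and ξ ∈ ℝⁿ a vector with Aξ = λξ. Let m ≥ 1 and let μ be a real number with S_m(μ) = λ·S_{m−1}(μ). Let Ã = A(P_m) ⊗ I_n + D_1 ⊗ A, and let η be the vector (S_{m−1}(μ), S_{m−2}(μ), …, S_0(μ))ᵀ ⊗ ξ ∈ ℝ^{mn}, i.e., the vector whose (j,i)-th entry is S_{m−j}(μ)·ξ_i for j = 1,…,m and i = 1,…,n. Then Ã η = μ η. -/
open Polynomial Matrix Kronecker

theorem chebS_eval_add_one (k : ℤ) (x : ℝ) :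
    (chebS (k + 1)).eval x = x * (chebS k).eval x - (chebS (k - 1)).eval x := by
  simp only [chebS, Polynomial.Chebyshev.U_add_one, eval_comp, eval_sub, eval_mul, eval_ofNat,
    eval_X, eval_C]
  ring

theorem chebS_neg_one : chebS (-1) = 0 := by
  simp [chebS]

theorem sum_pathAdj_mul (m : ℕ) (j : Fin m) (g : ℤ → ℝ) :
    ∑ k, pathAdj m j k * g (k : ℕ) =
      (if (j : ℕ) + 1 < m then g ((j : ℕ) + 1) else 0) +
        (if (j : ℕ) = 0 then 0 else g ((j : ℕ) - 1)) := by
  have hj := j.isLt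
  have hsplit (k : ℕ) :
      (if (j : ℕ) + 1 = k ∨ k + 1 = (j : ℕ) then (1 : ℝ) else 0) * g k =
        (if (j : ℕ) + 1 = k then g k else 0) +
          (if (j : ℕ) - 1 = k then (if (j : ℕ) = 0 then 0 else g k) else 0) := by
    split_ifs <;> first | omega | simp
  simp only [pathAdj, Matrix.of_apply]
  rw [Fin.sum_univ_eq_sum_range
    (fun k : ℕ => (if (j : ℕ) + 1 = k ∨ k + 1 = (j : ℕ) then (1 : ℝ) else 0) * g k) m]
  simp only [hsplit, Finset.sum_add_distrib, Finset.sum_ite_eq, Finset.mem_range]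
  congr 1
  rw [if_pos (by omega)]
  split_ifs with h
  · rfl
  · rw [Nat.cast_pred (Nat.pos_of_ne_zero h)]

theorem sum_D1_mul (m : ℕ) (j : Fin m) (f : Fin m → ℝ) :
    ∑ k, D1 m j k * f k = if (j : ℕ) = 0 then f j else 0 := by
  simp [D1, ite_and]

theorem rooted_product_eigenvector {n : ℕ} (A : Matrix (Fin n) (Fin n) ℝ)
    (lam : ℝ) (xi : Fin n → ℝ) (hxi : A.mulVec xi = lam • xi)
    (m : ℕ) (hm : 1 ≤ m) (mu : ℝ)
    (hmu : (chebS m).eval mu = lam * (chebS ((m : ℤ) - 1)).eval mu)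
    (Atil : Matrix (Fin m × Fin n) (Fin m × Fin n) ℝ)
    (hAtil : Atil = pathAdj m ⊗ₖ (1 : Matrix (Fin n) (Fin n) ℝ) + D1 m ⊗ₖ A)
    (eta : Fin m × Fin n → ℝ)
    (heta : ∀ j i, eta (j, i) = (chebS ((m : ℤ) - 1 - (j : ℕ))).eval mu * xi i) :
    Atil.mulVec eta = mu • eta := by
  have hA (i : Fin n) : ∑ l, A i l * xi l = lam * xi i := by
    simpa [Matrix.mulVec, dotProduct] using congrFun hxi i
  ext ⟨j, i⟩
  have hj := j.isLt
  let s : ℤ → ℝ := fun k => (chebS ((m : ℤ) - 1 - k)).eval mu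
  have hrec : s ((j : ℕ) - 1) = mu * s (j : ℕ) - s ((j : ℕ) + 1) := by
    have h := chebS_eval_add_one ((m : ℤ) - 1 - (j : ℕ)) mu
    simp only [s]
    convert h using 4 <;> ring_nf
  have hlast (h : ¬(j : ℕ) + 1 < m) : s ((j : ℕ) + 1) = 0 := by
    have : (m : ℤ) - 1 - ((j : ℕ) + 1) = -1 := by omega
    simp [s, this, chebS_neg_one]
  have hpath : ∑ k, pathAdj m j k * s (k : ℕ) =
      s ((j : ℕ) + 1) + (if (j : ℕ) = 0 then 0 else s ((j : ℕ) - 1)) := by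
    rw [sum_pathAdj_mul]
    split_ifs with h <;> simp [hlast, h]
  have hfirst (h : (j : ℕ) = 0) : s ((j : ℕ) - 1) = lam * s (j : ℕ) := by
    simpa [s, h] using hmu
  have hexpand : Atil.mulVec eta (j, i) =
      (∑ k, pathAdj m j k * s (k : ℕ)) * xi i +
        (∑ k, D1 m j k * s (k : ℕ)) * ∑ l, A i l * xi l := by
    simp only [hAtil, Matrix.mulVec, dotProduct, Fintype.sum_prod_type, heta, Matrix.add_apply,
      Matrix.kroneckerMap_apply, add_mul, Finset.sum_add_distrib]
    congr 1
    · simp [Matrix.one_apply, Finset.sum_mul, s, mul_assoc]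
    · rw [Finset.sum_mul_sum]
      exact Finset.sum_congr rfl fun k _ => Finset.sum_congr rfl fun l _ => by
        simp only [s]
        ring
  rw [hexpand, hpath, sum_D1_mul m j fun k => s (k : ℕ), hA, Pi.smul_apply, smul_eq_mul, heta]
  change _ = mu * (s (j : ℕ) * xi i)
  split_ifs with h
  · linear_combination xi i * hrec - xi i * hfirst h
  · linear_combination xi i * hrec
end

section
/- Let A be a real symmetric n×n matrix whose characteristic polynomial factors as det(xI − A) = ∏_{i=1}^n (x − λ_i) with λ_1, …, λ_n real, and let m ≥ 1. Let Ã = A(P_m) ⊗ I_n + D_1 ⊗ A. Then the characteristic polynomial of the mn×mn matrix Ã satisfies det(xI − Ã) = ∏_{i=1}^n (S_m(x) − λ_i·S_{m−1}(x)). -/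
open Polynomial Matrix Kronecker

lemma chebS_zero : chebS 0 = 1 := by simp [chebS]

lemma chebS_one : chebS 1 = X := by
  have h : (2 : ℝ[X]) = C 2 := rfl
  simp [chebS, h, ← mul_assoc, ← C_mul]

lemma chebS_add_two (k : ℤ) : chebS (k + 2) = X * chebS (k + 1) - chebS k := by
  have h : (2 : ℝ[X]) * (C 2⁻¹ * X) = X := by
    have h2 : (2 : ℝ[X]) = C 2 := rfl
    rw [h2, ← mul_assoc, ← C_mul]
    simp
  simp only [chebS, Chebyshev.U_add_two, sub_comp, mul_comp, ofNat_comp, X_comp, Nat.cast_ofNat, h]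

/-- Laplace expansion along the first row and the first column. -/
lemma charpoly_pathAdj_add_smul_D1_add_two (m : ℕ) (a : ℝ) :
    (pathAdj (m + 2) + a • D1 (m + 2)).charpoly =
      (X - C a) * (pathAdj (m + 1)).charpoly - (pathAdj m).charpoly := by
  set M := (pathAdj (m + 2) + a • D1 (m + 2)).charmatrix with hM
  have h00 : M 0 0 = X - C a := by
    simp [hM, pathAdj, D1]
  have h01 : M 0 1 = -1 := by
    simp [hM, pathAdj, D1]
  have h10 : M 1 0 = -1 := by
    simp [hM, pathAdj, D1]
  have h0 (j : Fin m) : M 0 j.succ.succ = 0 := by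
    rw [hM, charmatrix_apply_ne _ _ _ (Fin.succ_ne_zero _).symm]
    simp [pathAdj, D1, (Fin.succ_ne_zero j.succ).symm]
  have h0' (j : Fin m) : M j.succ.succ 0 = 0 := by
    rw [hM, charmatrix_apply_ne _ _ _ (Fin.succ_ne_zero _)]
    simp [pathAdj, D1]
  have hminor : M.submatrix Fin.succ Fin.succ = (pathAdj (m + 1)).charmatrix := by
    ext1 i j
    simp [hM, charmatrix_apply, pathAdj, D1, diagonal_apply]
  have hminor2 : M.submatrix (fun i : Fin m => i.succ.succ) (fun i : Fin m => i.succ.succ) =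
      (pathAdj m).charmatrix := by
    ext1 i j
    simp [hM, charmatrix_apply, pathAdj, D1, diagonal_apply]
  have hdet : (M.submatrix Fin.succ (Fin.succAbove 1)).det = -(pathAdj m).charpoly := by
    rw [det_succ_column_zero, Fin.sum_univ_succ, Finset.sum_eq_zero]
    · rw [charpoly, ← hminor2]
      simp [h10]
      rfl
    · intro i _
      simp [h0']
  rw [charpoly, ← hM, det_succ_row_zero, Fin.sum_univ_succ, Fin.sum_univ_succ,
    Finset.sum_eq_zero]
  · simp only [Fin.succ_zero_eq_one, Fin.succAbove_zero, hminor, hdet, h00, h01, charpoly]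
    simp
    ring
  · intro i _
    simp [h0]

lemma charpoly_pathAdj (m : ℕ) : (pathAdj m).charpoly = chebS m := by
  induction m using Nat.twoStepInduction with
  | zero => simp [charpoly, chebS_zero]
  | one => simp [charpoly, pathAdj, chebS_one]
  | more m ih ih' =>
    have h := charpoly_pathAdj_add_smul_D1_add_two m 0
    simp only [zero_smul, add_zero, map_zero, sub_zero, ih, ih'] at h
    rw [h]
    push_cast
    rw [chebS_add_two]

lemma charpoly_pathAdj_add_smul_D1 {m : ℕ} (hm : 1 ≤ m) (a : ℝ) :
    (pathAdj m + a • D1 m).charpoly = chebS m - C a * chebS ((m : ℤ) - 1) := by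
  match m, hm with
  | 1, _ => simp [charpoly, pathAdj, D1, chebS_one, chebS_zero]
  | m + 2, _ =>
    rw [charpoly_pathAdj_add_smul_D1_add_two, charpoly_pathAdj, charpoly_pathAdj]
    have h : ((m + 2 : ℕ) : ℤ) - 1 = m + 1 := by push_cast; ring
    rw [h]
    push_cast
    rw [chebS_add_two]
    ring

lemma charpoly_blockDiagonal {R m o : Type*} [CommRing R] [Fintype m] [DecidableEq m]
    [Fintype o] [DecidableEq o] (M : o → Matrix m m R) :
    (blockDiagonal M).charpoly = ∏ i, (M i).charpoly := by
  simp only [charpoly]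
  rw [← det_blockDiagonal]
  congr 1
  ext1 ⟨i, k⟩ ⟨j, l⟩
  by_cases h : k = l <;>
    simp [charmatrix_apply, blockDiagonal_apply, diagonal_apply, h]

/-- If `B = U * D * V` with `V * U = 1`, then `B` may be replaced by `D` on the right of the
Kronecker products. -/
lemma charpoly_kronecker_one_add_kronecker_conj {R m n : Type*} [CommRing R]
    [Fintype m] [DecidableEq m] [Fintype n] [DecidableEq n] (P Q : Matrix m m R)
    (D U V : Matrix n n R) (hVU : V * U = 1) :
    (P ⊗ₖ (1 : Matrix n n R) + Q ⊗ₖ (U * D * V)).charpoly =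
      (P ⊗ₖ (1 : Matrix n n R) + Q ⊗ₖ D).charpoly := by
  have hUV : U * V = 1 := mul_eq_one_comm.mp hVU
  have h : P ⊗ₖ (1 : Matrix n n R) + Q ⊗ₖ (U * D * V) =
      (1 : Matrix m m R) ⊗ₖ U * ((P ⊗ₖ (1 : Matrix n n R) + Q ⊗ₖ D) * (1 : Matrix m m R) ⊗ₖ V) := by
    simp only [add_mul, mul_add, ← mul_kronecker_mul, one_mul, mul_one, hUV, mul_assoc]
  rw [h, charpoly_mul_comm, mul_assoc, ← mul_kronecker_mul, hVU, one_mul, one_kronecker_one,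
    mul_one]

theorem rooted_product_charpoly {n : ℕ} (A : Matrix (Fin n) (Fin n) ℝ)
    (hsym : A.IsSymm) (lam : Fin n → ℝ)
    (hchar : A.charpoly = ∏ i : Fin n, (X - C (lam i)))
    (m : ℕ) (hm : 1 ≤ m)
    (Atil : Matrix (Fin m × Fin n) (Fin m × Fin n) ℝ)
    (hAtil : Atil = pathAdj m ⊗ₖ (1 : Matrix (Fin n) (Fin n) ℝ) + D1 m ⊗ₖ A) :
    Atil.charpoly = ∏ i : Fin n, (chebS m - C (lam i) * chebS ((m : ℤ) - 1)) := by
  have hA : A.IsHermitian := by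
    rw [IsHermitian, conjTranspose_eq_transpose_of_trivial]
    exact hsym
  have hroots : Finset.univ.val.map lam = Finset.univ.val.map hA.eigenvalues := by
    have h := hchar.symm.trans hA.charpoly_eq
    have h' := congrArg roots h
    simpa [roots_prod, Finset.prod_ne_zero_iff, X_sub_C_ne_zero] using h'
  have hprod : ∏ i, (chebS m - C (lam i) * chebS ((m : ℤ) - 1)) =
      ∏ i, (chebS m - C (hA.eigenvalues i) * chebS ((m : ℤ) - 1)) := by
    have h := congrArg
      (fun s => (s.map fun a : ℝ => chebS m - C a * chebS ((m : ℤ) - 1)).prod) hroots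
    simpa only [Multiset.map_map, Function.comp_def, Finset.prod_map_val] using h
  have hspec : A = (hA.eigenvectorUnitary : Matrix (Fin n) (Fin n) ℝ) *
      diagonal hA.eigenvalues * star (hA.eigenvectorUnitary : Matrix (Fin n) (Fin n) ℝ) := by
    simpa [Unitary.conjStarAlgAut_apply, Function.comp_def] using hA.spectral_theorem
  have hblock : pathAdj m ⊗ₖ (1 : Matrix (Fin n) (Fin n) ℝ) + D1 m ⊗ₖ diagonal hA.eigenvalues =
      blockDiagonal fun i => pathAdj m + hA.eigenvalues i • D1 m := by
    rw [kronecker_one, kronecker_diagonal, ← blockDiagonal_add]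
    congr 1
    ext i j k
    simp [mul_comm]
  have hconj := charpoly_kronecker_one_add_kronecker_conj (pathAdj m) (D1 m)
    (diagonal hA.eigenvalues) _ _ (Unitary.coe_star_mul_self hA.eigenvectorUnitary)
  rw [← hspec] at hconj
  rw [hAtil, hprod, hconj, hblock, charpoly_blockDiagonal]
  exact Finset.prod_congr rfl fun i _ => charpoly_pathAdj_add_smul_D1 hm _
end

section
/- For every integer m ≥ 1 and every complex number t, the resultant of the polynomials U_m(x) + t·U_{m−1}(x) and ∑_{k=0}^{m−1} U_k(x) equals (−1)^{m(m−1)/2} · t^⌊m/2⌋ · 2^{m(m−1)}. -/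
open Polynomial

/-- The resultant of two complex polynomials `f = aₙ∏(x-αᵢ)`, `g = bₘ∏(x-βⱼ)`:
`Res(f,g) = aₙ^m · bₘ^n · ∏ᵢⱼ (αᵢ - βⱼ)`. -/
noncomputable def res (f g : Polynomial ℂ) : ℂ :=
  f.leadingCoeff ^ g.natDegree * g.leadingCoeff ^ f.natDegree *
    (f.roots.map fun a => (g.roots.map fun b => a - b).prod).prod

theorem res_eq_prod_eval (f g : ℂ[X]) :
    res f g = (-1) ^ (f.natDegree * g.natDegree) * g.leadingCoeff ^ f.natDegree *
      (g.roots.map f.eval).prod := by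
  have hf (b : ℂ) : f.eval b =
      f.leadingCoeff * ((-1) ^ f.natDegree * (f.roots.map fun a => a - b).prod) := by
    have hs := IsAlgClosed.splits f
    have hn := (f.roots.map fun a => a - b).prod_map_neg
    rw [Multiset.card_map, Multiset.map_map] at hn
    rw [hs.eval_eq_prod_roots, hs.natDegree_eq_card_roots, ← hn]
    simp
  have hc : g.roots.card = g.natDegree := (IsAlgClosed.splits g).natDegree_eq_card_roots.symm
  have hsq : ((-1 : ℂ) ^ (f.natDegree * g.natDegree)) * (-1) ^ (f.natDegree * g.natDegree) = 1 := by
    rw [← mul_pow]; simp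
  rw [res, Multiset.prod_map_prod_map, funext hf]
  simp only [Multiset.prod_map_mul, Multiset.map_const', Multiset.prod_replicate, hc, ← pow_mul]
  linear_combination (-f.leadingCoeff ^ g.natDegree * g.leadingCoeff ^ f.natDegree *
    (g.roots.map fun b => (f.roots.map fun a => a - b).prod).prod) * hsq

namespace Polynomial.Chebyshev

theorem U_doubling {R : Type*} [CommRing R] (n : ℕ) :
    U R n ^ 2 - 2 * X * U R n * U R (n - 1) + U R (n - 1) ^ 2 = 1 ∧
    U R (2 * n) = U R n ^ 2 - U R (n - 1) ^ 2 ∧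
    U R (2 * n - 1) = 2 * U R (n - 1) * (U R n - X * U R (n - 1)) := by
  induction n with
  | zero => simp
  | succ n ih =>
    obtain ⟨h₁, h₂, h₃⟩ := ih
    have e₁ := U_add_one R n
    have e₂ := U_add_one R (2 * n)
    have e₃ := U_add_one R (2 * n + 1)
    push_cast
    rw [show (2 * (n + 1) : ℤ) = 2 * n + 1 + 1 by ring,
      show (2 * n + 1 + 1 - 1 : ℤ) = 2 * n + 1 by ring, show (n + 1 - 1 : ℤ) = n by ring]
    rw [show (2 * n + 1 - 1 : ℤ) = 2 * n by ring] at e₃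
    rw [e₃, e₂, h₂, h₃, e₁]
    exact ⟨by linear_combination h₁, by ring, by ring⟩

theorem U_two_mul_add_one {R : Type*} [CommRing R] (n : ℕ) :
    U R (2 * n + 1) = 2 * U R n * (X * U R n - U R (n - 1)) := by
  obtain ⟨-, h₂, h₃⟩ := U_doubling (R := R) n
  rw [U_add_one, h₂, h₃]
  ring

theorem sum_range_two_mul_U {R : Type*} [CommRing R] (n : ℕ) :
    ∑ k ∈ Finset.range (2 * n), U R k = U R (n - 1) * (U R n + U R (n - 1)) := by
  induction n with
  | zero => simp
  | succ n ih =>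
    rw [show 2 * (n + 1) = 2 * n + 1 + 1 by ring, Finset.sum_range_succ, Finset.sum_range_succ, ih]
    push_cast
    rw [(U_doubling n).2.1, U_two_mul_add_one, show (n + 1 - 1 : ℤ) = n by ring, U_add_one]
    ring

theorem sum_range_two_mul_add_one_U {R : Type*} [CommRing R] (n : ℕ) :
    ∑ k ∈ Finset.range (2 * n + 1), U R k = U R n * (U R n + U R (n - 1)) := by
  rw [Finset.sum_range_succ, sum_range_two_mul_U]
  push_cast
  rw [(U_doubling n).2.1]
  ring

section Domain

variable {R : Type*} [CommRing R] [IsDomain R] [NeZero (2 : R)]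

theorem degree_C_mul_U_sub_one_lt (n : ℕ) (t : R) :
    (Polynomial.C t * U R ((n : ℤ) - 1)).degree < (U R n).degree := by
  rw [degree_U_natCast]
  cases n with
  | zero => simp
  | succ n =>
    rw [show ((n + 1 : ℕ) : ℤ) - 1 = n by push_cast; ring, ← smul_eq_C_mul]
    refine (degree_smul_le t _).trans_lt ?_
    rw [degree_U_natCast]
    exact_mod_cast n.lt_succ_self

theorem natDegree_U_add_C_mul_U (n : ℕ) (t : R) :
    (U R n + Polynomial.C t * U R ((n : ℤ) - 1)).natDegree = n := by
  rw [natDegree_eq_of_degree_eq (degree_add_eq_left_of_degree_lt (degree_C_mul_U_sub_one_lt n t)),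
    natDegree_U_natCast]

theorem leadingCoeff_U_add_C_mul_U (n : ℕ) (t : R) :
    (U R n + Polynomial.C t * U R ((n : ℤ) - 1)).leadingCoeff = 2 ^ n := by
  rw [leadingCoeff_add_of_degree_lt' (degree_C_mul_U_sub_one_lt n t), leadingCoeff_U_natCast]

theorem natDegree_U_add_U (n : ℕ) : (U R n + U R ((n : ℤ) - 1)).natDegree = n := by
  simpa using natDegree_U_add_C_mul_U n (1 : R)

theorem leadingCoeff_U_add_U (n : ℕ) : (U R n + U R ((n : ℤ) - 1)).leadingCoeff = 2 ^ n := by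
  simpa using leadingCoeff_U_add_C_mul_U n (1 : R)

end Domain

end Polynomial.Chebyshev

/-- If `f` is congruent to a constant modulo `p`, then it takes that value at the roots of `p`. -/
theorem prod_map_eval_roots_of_dvd {f p : ℂ[X]} {c : ℂ} (h : p ∣ f - C c) :
    (p.roots.map f.eval).prod = c ^ p.natDegree := by
  rw [(IsAlgClosed.splits p).natDegree_eq_card_roots, ← Multiset.prod_replicate,
    ← Multiset.map_const']
  congr 1
  refine Multiset.map_congr rfl fun b hb => ?_
  have := ((isRoot_of_mem_roots hb).dvd h).eq_zero
  simpa [sub_eq_zero] using this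

/-- The resultant of `f` and `p * q` when `f` is constant modulo `p` and modulo `q`. -/
theorem res_mul_of_dvd {f p q : ℂ[X]} {c d : ℂ} (hpq : p * q ≠ 0) (hp : p ∣ f - C c)
    (hq : q ∣ f - C d) :
    res f (p * q) = (-1) ^ (f.natDegree * (p.natDegree + q.natDegree)) *
      (p.leadingCoeff * q.leadingCoeff) ^ f.natDegree * (c ^ p.natDegree * d ^ q.natDegree) := by
  rw [res_eq_prod_eval, roots_mul hpq, Multiset.map_add, Multiset.prod_add,
    prod_map_eval_roots_of_dvd hp, prod_map_eval_roots_of_dvd hq, leadingCoeff_mul,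
    natDegree_mul (left_ne_zero_of_mul hpq) (right_ne_zero_of_mul hpq)]

theorem resultant_chebyshevU_combination_sum (m : ℕ) (hm : 1 ≤ m) (t : ℂ) :
    res (Chebyshev.U ℂ m + C t * Chebyshev.U ℂ ((m : ℤ) - 1))
        (∑ k ∈ Finset.range m, Chebyshev.U ℂ k) =
      (-1) ^ (m * (m - 1) / 2) * t ^ (m / 2) * 2 ^ (m * (m - 1)) := by
  have hW (n : ℕ) : Chebyshev.U ℂ n + Chebyshev.U ℂ ((n : ℤ) - 1) ≠ 0 := fun h => by
    have := Chebyshev.leadingCoeff_U_add_U (R := ℂ) n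
    rw [h, leadingCoeff_zero] at this
    exact pow_ne_zero n two_ne_zero this.symm
  have hU (n : ℕ) : Chebyshev.U ℂ n ≠ 0 := Chebyshev.U_ne_zero ℂ n (by lia)
  obtain ⟨n, rfl | rfl⟩ := m.even_or_odd'
  · obtain ⟨k, rfl⟩ : ∃ k, n = k + 1 := ⟨n - 1, by lia⟩
    have hk : (((k + 1 : ℕ) : ℤ) - 1) = k := by push_cast; ring
    have hne : Chebyshev.U ℂ (((k + 1 : ℕ) : ℤ) - 1) ≠ 0 := hk ▸ hU k
    obtain ⟨h₁, h₂, h₃⟩ := Chebyshev.U_doubling (R := ℂ) (k + 1)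
    rw [Chebyshev.sum_range_two_mul_U,
      res_mul_of_dvd (c := 1) (d := -t) (mul_ne_zero hne (hW (k + 1))),
      Chebyshev.natDegree_U_add_C_mul_U, Chebyshev.natDegree_U_add_U, Chebyshev.leadingCoeff_U_add_U,
      hk, Chebyshev.natDegree_U_natCast, Chebyshev.leadingCoeff_U_natCast]
    · rw [show 2 * (k + 1) * (2 * (k + 1) - 1) / 2 = 2 * (k * (k + 1)) + (k + 1) by
          rw [show 2 * (k + 1) - 1 = 2 * k + 1 by lia, mul_assoc,
            Nat.mul_div_cancel_left _ two_pos]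
          ring,
        Nat.mul_div_cancel_left _ two_pos, ← pow_add, ← pow_mul,
        show (k + (k + 1)) * (2 * (k + 1)) = 2 * (k + 1) * (2 * (k + 1) - 1) by
          rw [show 2 * (k + 1) - 1 = 2 * k + 1 by lia]; ring,
        neg_pow t, pow_add (-1 : ℂ) (2 * _), mul_assoc 2 (k + 1), pow_mul (-1 : ℂ) 2,
        pow_mul (-1 : ℂ) 2]
      simp only [neg_one_sq, one_pow, one_mul]
      ring
    · refine ⟨2 * X * Chebyshev.U ℂ (k + 1 : ℕ) - 2 * Chebyshev.U ℂ ((k + 1 : ℕ) - 1) +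
        C t * (2 * (Chebyshev.U ℂ (k + 1 : ℕ) - X * Chebyshev.U ℂ ((k + 1 : ℕ) - 1))), ?_⟩
      rw [Nat.cast_mul, Nat.cast_two, h₂, h₃, C_1]
      linear_combination h₁
    · refine ⟨Chebyshev.U ℂ (k + 1 : ℕ) - Chebyshev.U ℂ ((k + 1 : ℕ) - 1) +
        C t * (Chebyshev.U ℂ (k + 1 : ℕ) + Chebyshev.U ℂ ((k + 1 : ℕ) - 1) -
          2 * X * Chebyshev.U ℂ ((k + 1 : ℕ) - 1)), ?_⟩
      rw [Nat.cast_mul, Nat.cast_two, h₂, h₃, C_neg]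
      linear_combination -C t * h₁
  · obtain ⟨h₁, h₂, -⟩ := Chebyshev.U_doubling (R := ℂ) n
    have hm₁ : (((2 * n + 1 : ℕ) : ℤ) - 1) = 2 * n := by push_cast; ring
    rw [Chebyshev.sum_range_two_mul_add_one_U,
      res_mul_of_dvd (c := -t) (d := 1) (mul_ne_zero (hU n) (hW n)),
      Chebyshev.natDegree_U_add_C_mul_U, Chebyshev.natDegree_U_add_U, Chebyshev.leadingCoeff_U_add_U,
      Chebyshev.natDegree_U_natCast, Chebyshev.leadingCoeff_U_natCast]
    · rw [Nat.add_sub_cancel,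
        show (2 * n + 1) * (2 * n) / 2 = 2 * (n * n) + n by
          rw [mul_left_comm, Nat.mul_div_cancel_left _ two_pos]; ring,
        show (2 * n + 1) / 2 = n by lia, ← pow_add, ← pow_mul,
        show (n + n) * (2 * n + 1) = (2 * n + 1) * (2 * n) by ring,
        show (2 * n + 1) * (n + n) = 2 * (n * (2 * n + 1)) by ring,
        neg_pow t, pow_add, pow_mul (-1 : ℂ) 2, pow_mul (-1 : ℂ) 2]
      simp only [neg_one_sq, one_pow, one_mul]
      ring
    · refine ⟨2 * (X * Chebyshev.U ℂ n - Chebyshev.U ℂ (n - 1)) +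
        C t * (2 * Chebyshev.U ℂ n - 2 * X * Chebyshev.U ℂ (n - 1)), ?_⟩
      rw [hm₁, h₂, Nat.cast_succ, Nat.cast_mul, Nat.cast_two, Chebyshev.U_two_mul_add_one, C_neg]
      linear_combination -C t * h₁
    · refine ⟨2 * X * Chebyshev.U ℂ n - (Chebyshev.U ℂ n + Chebyshev.U ℂ (n - 1)) +
        C t * (Chebyshev.U ℂ n - Chebyshev.U ℂ (n - 1)), ?_⟩
      rw [hm₁, h₂, Nat.cast_succ, Nat.cast_mul, Nat.cast_two, Chebyshev.U_two_mul_add_one, C_1]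
      linear_combination h₁
end

section
/- For every integer m ≥ 1, the resultant of the Chebyshev polynomials U_m(x) and U_{m−1}(x) equals (−1)^{m(m−1)/2}·2^{m(m−1)}. -/
open Polynomial

/-- The product formula `res` agrees with the determinant of the Sylvester matrix. -/
theorem res_eq_resultant (f g : ℂ[X]) : res f g = resultant f g := by
  rw [resultant_eq_prod_eval f g _ le_rfl (IsAlgClosed.splits f), res,
    (IsAlgClosed.splits f).natDegree_eq_card_roots]
  simp_rw [fun x => (IsAlgClosed.splits g).eval_eq_prod_roots x, Multiset.prod_map_mul,
    Multiset.map_const', Multiset.prod_replicate, mul_assoc]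

/-- Consecutive resultants of Chebyshev polynomials of the second kind satisfy a two-term
recurrence. -/
theorem resultant_chebyshevU_recurrence (k : ℕ) :
    resultant (Chebyshev.U ℂ ((k + 2 : ℕ) : ℤ)) (Chebyshev.U ℂ ((k + 1 : ℕ) : ℤ)) (k + 2) (k + 1) =
      (-1) ^ (k + 1) * 2 ^ (2 * (k + 1)) *
        resultant (Chebyshev.U ℂ ((k + 1 : ℕ) : ℤ)) (Chebyshev.U ℂ (k : ℤ)) (k + 1) k := by
  have hU : Chebyshev.U ℂ ((k + 2 : ℕ) : ℤ) =
      C (-1) * Chebyshev.U ℂ (k : ℤ) + Chebyshev.U ℂ ((k + 1 : ℕ) : ℤ) * (2 * X) := by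
    push_cast
    rw [Chebyshev.U_add_two, C_neg, C_1]
    ring
  have hX : (2 * X : ℂ[X]).natDegree ≤ 1 := by
    simp
  have hlead : (Chebyshev.U ℂ ((k + 1 : ℕ) : ℤ)).coeff (k + 1) = 2 ^ (k + 1) := by
    simpa only [leadingCoeff, Chebyshev.natDegree_U_natCast] using
      Chebyshev.leadingCoeff_U_natCast ℂ (k + 1)
  rw [hU, resultant_add_mul_left _ _ _ _ _ (by omega) (Chebyshev.natDegree_U_natCast ℂ _).le,
    resultant_C_mul_left,
    resultant_add_left_deg _ _ k (k + 1) 2 (Chebyshev.natDegree_U_natCast ℂ _).le, hlead,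
    resultant_comm, (Nat.even_mul_succ_self k).neg_one_pow, (even_two.mul_left (k + 1)).neg_one_pow]
  ring

theorem resultant_chebyshevU_succ (m : ℕ) (hm : 1 ≤ m) :
    res (Chebyshev.U ℂ m) (Chebyshev.U ℂ ((m : ℤ) - 1)) =
      (-1) ^ (m * (m - 1) / 2) * 2 ^ (m * (m - 1)) := by
  obtain ⟨k, rfl⟩ := Nat.exists_eq_add_of_le' hm
  have hk : (((k + 1 : ℕ) : ℤ) - 1) = (k : ℤ) := by simp
  rw [hk, res_eq_resultant, Chebyshev.natDegree_U_natCast, Chebyshev.natDegree_U_natCast]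
  clear hm hk
  induction k with
  | zero => simp
  | succ k ih =>
    have hexp : (k + 1 + 1) * (k + 1 + 1 - 1) = (k + 1) * (k + 1 - 1) + 2 * (k + 1) := by
      simp only [Nat.add_sub_cancel]
      ring
    rw [resultant_chebyshevU_recurrence, ih, hexp,
      Nat.add_mul_div_left _ _ two_pos, pow_add, pow_add]
    ring
end

section
/- Let m ≥ 1. The m−1 = ⌊m/2⌋ + ⌊(m−1)/2⌋ real numbers cos(2πj/(m+1)) for 1 ≤ j ≤ ⌊m/2⌋ together with cos(2πj/m) for 1 ≤ j ≤ ⌊(m−1)/2⌋ are pairwise distinct, and they are precisely the roots of the degree-(m−1) polynomial ∑_{k=0}^{m−1} U_k(x). -/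
open Polynomial Real

theorem degree_sum_range_chebyshevU (n : ℕ) :
    (∑ k ∈ Finset.range (n + 1), Chebyshev.U ℝ k).degree = n := by
  induction n with
  | zero => simp
  | succ n ih =>
    rw [Finset.sum_range_succ, degree_add_eq_right_of_degree_lt, Chebyshev.degree_U_natCast]
    rw [ih, Chebyshev.degree_U_natCast]
    exact_mod_cast Nat.lt_succ_self n

theorem eval_cos_sum_range_chebyshevU (m : ℕ) (θ : ℝ) :
    (∑ k ∈ Finset.range m, Chebyshev.U ℝ k).eval (Real.cos θ) * Real.sin θ * Real.sin (θ / 2) =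
      Real.sin (m * (θ / 2)) * Real.sin ((m + 1) * (θ / 2)) := by
  induction m with
  | zero => simp
  | succ m ih =>
    rw [Finset.sum_range_succ, eval_add, add_mul, add_mul, ih, Chebyshev.U_real_cos]
    push_cast
    rw [show (m : ℝ) * (θ / 2) = (m + 1) * (θ / 2) - θ / 2 by ring,
      show ((m : ℝ) + 1 + 1) * (θ / 2) = (m + 1) * (θ / 2) + θ / 2 by ring,
      show ((m : ℝ) + 1) * θ = 2 * ((m + 1) * (θ / 2)) by ring,
      Real.sin_two_mul, Real.sin_add, Real.sin_sub]
    ring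

theorem two_pi_mul_div_mem_Ioo {j n : ℕ} (hj : 1 ≤ j) (hjn : 2 * j < n) :
    2 * π * j / n ∈ Set.Ioo 0 π := by
  have hn : (0 : ℝ) < n := by exact_mod_cast (by omega : 0 < n)
  have hj' : (0 : ℝ) < j := by exact_mod_cast hj
  have hjn' : (2 : ℝ) * j < n := by exact_mod_cast hjn
  refine ⟨by positivity, ?_⟩
  rw [div_lt_iff₀ hn]
  nlinarith [Real.pi_pos]

theorem mul_eq_mul_of_cos_two_pi_mul_div_eq {j₁ n₁ j₂ n₂ : ℕ} (hj₁ : 1 ≤ j₁) (h₁ : 2 * j₁ < n₁)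
    (hj₂ : 1 ≤ j₂) (h₂ : 2 * j₂ < n₂)
    (h : Real.cos (2 * π * j₁ / n₁) = Real.cos (2 * π * j₂ / n₂)) : j₁ * n₂ = j₂ * n₁ := by
  have hn₁ : (n₁ : ℝ) ≠ 0 := by exact_mod_cast (by omega : n₁ ≠ 0)
  have hn₂ : (n₂ : ℝ) ≠ 0 := by exact_mod_cast (by omega : n₂ ≠ 0)
  have key := Real.injOn_cos (Set.Ioo_subset_Icc_self (two_pi_mul_div_mem_Ioo hj₁ h₁))
    (Set.Ioo_subset_Icc_self (two_pi_mul_div_mem_Ioo hj₂ h₂)) h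
  rw [div_eq_div_iff hn₁ hn₂, mul_assoc, mul_assoc (2 * π)] at key
  exact_mod_cast mul_left_cancel₀ (by positivity) key

theorem eval_sum_range_chebyshevU_eq_zero {m j n : ℕ} (hj : 1 ≤ j) (hjn : 2 * j < n)
    (hn : n = m ∨ n = m + 1) :
    (∑ k ∈ Finset.range m, Chebyshev.U ℝ k).eval (Real.cos (2 * π * j / n)) = 0 := by
  obtain ⟨h0, hπ⟩ := two_pi_mul_div_mem_Ioo hj hjn
  have hn0 : (n : ℝ) ≠ 0 := by exact_mod_cast (by omega : n ≠ 0)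
  have hs : Real.sin (n * (2 * π * j / n / 2)) = 0 := by
    rw [show (n : ℝ) * (2 * π * j / n / 2) = j * π by field_simp]
    exact Real.sin_nat_mul_pi j
  have key := eval_cos_sum_range_chebyshevU m (2 * π * j / n)
  have hrhs : Real.sin (m * (2 * π * j / n / 2)) * Real.sin ((m + 1) * (2 * π * j / n / 2)) = 0 := by
    rcases hn with rfl | rfl
    · rw [hs, zero_mul]
    · rw [← Nat.cast_add_one, hs, mul_zero]
  rw [hrhs, mul_assoc] at key
  exact (mul_eq_zero.mp key).resolve_right (mul_pos (Real.sin_pos_of_pos_of_lt_pi h0 hπ)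
    (Real.sin_pos_of_pos_of_lt_pi (by linarith) (by linarith))).ne'

theorem roots_sum_chebyshevU (m : ℕ) (hm : 1 ≤ m) :
    m - 1 = m / 2 + (m - 1) / 2 ∧
    (∑ k ∈ Finset.range m, Chebyshev.U ℝ k).natDegree = m - 1 ∧
    -- the numbers `cos (2πj/(m+1))`, `1 ≤ j ≤ ⌊m/2⌋`, are pairwise distinct
    (∀ j₁ j₂ : ℕ, 1 ≤ j₁ → j₁ ≤ m / 2 → 1 ≤ j₂ → j₂ ≤ m / 2 → j₁ ≠ j₂ →
      Real.cos (2 * π * j₁ / (m + 1)) ≠ Real.cos (2 * π * j₂ / (m + 1))) ∧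
    -- the numbers `cos (2πj/m)`, `1 ≤ j ≤ ⌊(m-1)/2⌋`, are pairwise distinct
    (∀ j₁ j₂ : ℕ, 1 ≤ j₁ → j₁ ≤ (m - 1) / 2 → 1 ≤ j₂ → j₂ ≤ (m - 1) / 2 → j₁ ≠ j₂ →
      Real.cos (2 * π * j₁ / m) ≠ Real.cos (2 * π * j₂ / m)) ∧
    -- the two families are disjoint
    (∀ j₁ j₂ : ℕ, 1 ≤ j₁ → j₁ ≤ m / 2 → 1 ≤ j₂ → j₂ ≤ (m - 1) / 2 →
      Real.cos (2 * π * j₁ / (m + 1)) ≠ Real.cos (2 * π * j₂ / m)) ∧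
    -- together they are precisely the roots of `∑_{k=0}^{m-1} U_k`
    (∀ x : ℝ, (∑ k ∈ Finset.range m, Chebyshev.U ℝ k).eval x = 0 ↔
      ((∃ j : ℕ, 1 ≤ j ∧ j ≤ m / 2 ∧ x = Real.cos (2 * π * j / (m + 1))) ∨
       (∃ j : ℕ, 1 ≤ j ∧ j ≤ (m - 1) / 2 ∧ x = Real.cos (2 * π * j / m)))) := by
  have hdeg : (∑ k ∈ Finset.range m, Chebyshev.U ℝ k).degree = (m - 1 : ℕ) := by
    obtain ⟨n, rfl⟩ := Nat.exists_eq_add_of_le' hm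
    exact degree_sum_range_chebyshevU n
  have hcard : m - 1 = m / 2 + (m - 1) / 2 := by omega
  have hdist₁ : ∀ j₁ j₂ : ℕ, 1 ≤ j₁ → j₁ ≤ m / 2 → 1 ≤ j₂ → j₂ ≤ m / 2 → j₁ ≠ j₂ →
      Real.cos (2 * π * j₁ / (m + 1)) ≠ Real.cos (2 * π * j₂ / (m + 1)) := by
    intro j₁ j₂ h₁ h₁' h₂ h₂' hne h
    rw [← Nat.cast_add_one] at h
    exact hne (Nat.eq_of_mul_eq_mul_right m.succ_pos
      (mul_eq_mul_of_cos_two_pi_mul_div_eq h₁ (by omega) h₂ (by omega) h))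
  have hdist₂ : ∀ j₁ j₂ : ℕ, 1 ≤ j₁ → j₁ ≤ (m - 1) / 2 → 1 ≤ j₂ → j₂ ≤ (m - 1) / 2 → j₁ ≠ j₂ →
      Real.cos (2 * π * j₁ / m) ≠ Real.cos (2 * π * j₂ / m) := by
    intro j₁ j₂ h₁ h₁' h₂ h₂' hne h
    exact hne (Nat.eq_of_mul_eq_mul_right hm
      (mul_eq_mul_of_cos_two_pi_mul_div_eq h₁ (by omega) h₂ (by omega) h))
  have hdisj : ∀ j₁ j₂ : ℕ, 1 ≤ j₁ → j₁ ≤ m / 2 → 1 ≤ j₂ → j₂ ≤ (m - 1) / 2 →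
      Real.cos (2 * π * j₁ / (m + 1)) ≠ Real.cos (2 * π * j₂ / m) := by
    intro j₁ j₂ h₁ h₁' h₂ h₂' h
    rw [← Nat.cast_add_one] at h
    have key := mul_eq_mul_of_cos_two_pi_mul_div_eq h₁ (by omega) h₂ (by omega) h
    have hdvd : m ∣ j₂ :=
      (Nat.coprime_self_add_right.mpr (Nat.coprime_one_right m)).dvd_of_dvd_mul_right
        (key ▸ Dvd.intro_left j₁ rfl)
    have := Nat.le_of_dvd h₂ hdvd
    omega
  refine ⟨hcard, natDegree_eq_of_degree_eq_some hdeg, hdist₁, hdist₂, hdisj, fun x => ⟨?_, ?_⟩⟩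
  · intro hx
    have hP : (∑ k ∈ Finset.range m, Chebyshev.U ℝ k) ≠ 0 := by
      rintro h
      simp [h] at hdeg
    set A := (Finset.Icc 1 (m / 2)).image fun j : ℕ => Real.cos (2 * π * j / (m + 1)) with hA
    set B := (Finset.Icc 1 ((m - 1) / 2)).image fun j : ℕ => Real.cos (2 * π * j / m) with hB
    have hAcard : A.card = m / 2 := by
      rw [hA, Finset.card_image_of_injOn, Nat.card_Icc, Nat.add_sub_cancel]
      intro i hi j hj hij
      rw [Finset.mem_coe, Finset.mem_Icc] at hi hj
      by_contra hne
      exact hdist₁ i j hi.1 hi.2 hj.1 hj.2 hne hij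
    have hBcard : B.card = (m - 1) / 2 := by
      rw [hB, Finset.card_image_of_injOn, Nat.card_Icc, Nat.add_sub_cancel]
      intro i hi j hj hij
      rw [Finset.mem_coe, Finset.mem_Icc] at hi hj
      by_contra hne
      exact hdist₂ i j hi.1 hi.2 hj.1 hj.2 hne hij
    have hAB : Disjoint A B := by
      rw [Finset.disjoint_left]
      intro y hyA hyB
      obtain ⟨i, hi, rfl⟩ := Finset.mem_image.mp hyA
      obtain ⟨j, hj, hij⟩ := Finset.mem_image.mp hyB
      rw [Finset.mem_Icc] at hi hj
      exact hdisj i j hi.1 hi.2 hj.1 hj.2 hij.symm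
    have hxAB : x ∈ A ∪ B := by
      by_contra hxn
      have hle : (insert x (A ∪ B)).card ≤ _ := card_le_degree_of_subset_roots
          (p := ∑ k ∈ Finset.range m, Chebyshev.U ℝ k) <| by
        intro y hy
        rw [mem_roots hP, IsRoot.def]
        rw [Finset.mem_val, Finset.mem_insert, Finset.mem_union] at hy
        rcases hy with rfl | hy | hy
        · exact hx
        · obtain ⟨j, hj, rfl⟩ := Finset.mem_image.mp hy
          rw [Finset.mem_Icc] at hj
          have h := eval_sum_range_chebyshevU_eq_zero (m := m) (n := m + 1) hj.1 (by omega) (.inr rfl)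
          rwa [Nat.cast_add_one] at h
        · obtain ⟨j, hj, rfl⟩ := Finset.mem_image.mp hy
          rw [Finset.mem_Icc] at hj
          exact eval_sum_range_chebyshevU_eq_zero hj.1 (by omega) (.inl rfl)
      rw [Finset.card_insert_of_notMem hxn, Finset.card_union_of_disjoint hAB, hAcard, hBcard,
        natDegree_eq_of_degree_eq_some hdeg] at hle
      omega
    rcases Finset.mem_union.mp hxAB with h | h
    · obtain ⟨j, hj, rfl⟩ := Finset.mem_image.mp h
      rw [Finset.mem_Icc] at hj
      exact .inl ⟨j, hj.1, hj.2, rfl⟩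
    · obtain ⟨j, hj, rfl⟩ := Finset.mem_image.mp h
      rw [Finset.mem_Icc] at hj
      exact .inr ⟨j, hj.1, hj.2, rfl⟩
  · rintro (⟨j, h₁, h₂, rfl⟩ | ⟨j, h₁, h₂, rfl⟩)
    · have h := eval_sum_range_chebyshevU_eq_zero (m := m) (n := m + 1) h₁ (by omega) (.inr rfl)
      rwa [Nat.cast_add_one] at h
    · exact eval_sum_range_chebyshevU_eq_zero h₁ (by omega) (.inl rfl)
end

section
/- Let A be a real symmetric n×n matrix with an orthonormal basis of eigenvectors ξ_1, …, ξ_n and corresponding real eigenvalues λ_1, …, λ_n (Aξ_i = λ_iξ_i), and let W = [e, Ae, …, A^{n−1}e] be the walk matrix of A, where e is the all-ones vector. Then det W = ε · ∏_{1≤i₁<i₂≤n} (λ_{i₂} − λ_{i₁}) · ∏_{i=1}^n (eᵀξ_i) for some ε ∈ {1, −1}. -/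
open Matrix

theorem vecMul_pow_of_vecMul_eq_smul {m R : Type*} [Fintype m] [DecidableEq m] [CommSemiring R]
    {A : Matrix m m R} {v : m → R} {c : R} (h : v ᵥ* A = c • v) (k : ℕ) :
    v ᵥ* A ^ k = c ^ k • v := by
  induction k with
  | zero => simp
  | succ k ih => rw [pow_succ, ← vecMul_vecMul, ih, smul_vecMul, h, smul_smul, ← pow_succ]

/-- Left eigenvectors, placed as rows, turn the walk matrix into a row-scaled Vandermonde matrix. -/
theorem of_mul_walkMatrix {n : ℕ} {A : Matrix (Fin n) (Fin n) ℝ} {lam : Fin n → ℝ}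
    {xi : Fin n → Fin n → ℝ} (h : ∀ i, xi i ᵥ* A = lam i • xi i) :
    of xi * walkMatrix A =
      diagonal (fun i => (fun _ => (1 : ℝ)) ⬝ᵥ xi i) * vandermonde lam := by
  ext i k
  have key : xi i ⬝ᵥ (A ^ (k : ℕ)) *ᵥ (fun _ => (1 : ℝ)) =
      ((fun _ => (1 : ℝ)) ⬝ᵥ xi i) * lam i ^ (k : ℕ) := by
    rw [dotProduct_mulVec, vecMul_pow_of_vecMul_eq_smul (h i), smul_dotProduct, smul_eq_mul,
      dotProduct_comm, mul_comm]
  rw [diagonal_mul, vandermonde_apply, ← key]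
  rfl

theorem det_walkMatrix_eq {n : ℕ} (A : Matrix (Fin n) (Fin n) ℝ) (hsym : A.IsSymm)
    (lam : Fin n → ℝ) (xi : Fin n → Fin n → ℝ)
    (horth : ∀ i j, xi i ⬝ᵥ xi j = if i = j then (1 : ℝ) else 0)
    (heig : ∀ i, A.mulVec (xi i) = lam i • xi i) :
    ∃ ε : ℝ, (ε = 1 ∨ ε = -1) ∧
      (walkMatrix A).det =
        ε * (∏ i₁ : Fin n, ∏ i₂ ∈ Finset.Ioi i₁, (lam i₂ - lam i₁)) *
          ∏ i : Fin n, (fun _ => (1 : ℝ)) ⬝ᵥ xi i := by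
  have hmul : of xi * (of xi)ᵀ = 1 := by
    ext i j
    rw [one_apply, ← horth i j]
    rfl
  have hdet : (of xi).det * (of xi).det = 1 := by
    simpa using congrArg det hmul
  have hleft : ∀ i, xi i ᵥ* A = lam i • xi i := fun i => by
    rw [← mulVec_transpose, hsym.eq, heig]
  have hW := congrArg det (of_mul_walkMatrix hleft)
  rw [det_mul, det_mul, det_diagonal, det_vandermonde] at hW
  refine ⟨(of xi).det, mul_self_eq_one_iff.mp hdet, ?_⟩
  rw [mul_assoc, mul_comm (∏ i₁ : Fin n, _), ← hW, ← mul_assoc, hdet, one_mul]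
end

section
/- Let A be a real n×n matrix such that the constant term of its characteristic polynomial is 1 or −1 (equivalently, det A = ±1), and let m ≥ 2. Then the constant term of the characteristic polynomial of the mn×mn matrix Ã = A(P_m) ⊗ I_n + D_1 ⊗ A is also 1 or −1 (equivalently, det Ã = ±1). -/
open Polynomial Matrix Kronecker

theorem det_pathAdj_two_kronecker_one_sq (n : ℕ) :
    (pathAdj 2 ⊗ₖ (1 : Matrix (Fin n) (Fin n) ℝ)).det ^ 2 = 1 := by
  have h : (pathAdj 2).det = -1 := by simp [Matrix.det_fin_two, pathAdj]
  rw [Matrix.det_kronecker, h, Matrix.det_one, one_pow, mul_one, ← pow_mul, mul_comm, pow_mul]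
  simp

theorem pathAdj_two_mul_self : pathAdj 2 * pathAdj 2 = 1 := by
  ext i j
  fin_cases i <;> fin_cases j <;> simp [pathAdj, Matrix.mul_apply]

theorem det_fromBlocks_of_mul_mul_eq_zero {ι κ R : Type*} [Fintype ι] [DecidableEq ι]
    [Fintype κ] [DecidableEq κ] [CommRing R] (A : Matrix ι ι R) (B : Matrix ι κ R)
    (C : Matrix κ ι R) (D : Matrix κ κ R) (hD : D * D = 1) (h : B * D * C = 0) :
    (fromBlocks A B C D).det = D.det * A.det := by
  let _ : Invertible D := ⟨D, hD, hD⟩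
  rw [Matrix.det_fromBlocks₂₂]
  change D.det * (A - B * D * C).det = _
  rw [h, sub_zero]

/-- The edge joining the last vertex of `P_m` to the first vertex of an appended `P_2`. -/
noncomputable def pathLink (m : ℕ) : Matrix (Fin m) (Fin 2) ℝ :=
  Matrix.of fun i j => if (i : ℕ) + 1 = m ∧ j = 0 then 1 else 0

theorem pathLink_mul_pathAdj_mul_transpose (m : ℕ) :
    pathLink m * pathAdj 2 * (pathLink m)ᵀ = 0 := by
  ext i j
  simp [pathLink, pathAdj, Matrix.mul_apply]

theorem pathAdj_add_two (m : ℕ) :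
    (pathAdj (m + 2)).submatrix finSumFinEquiv finSumFinEquiv =
      fromBlocks (pathAdj m) (pathLink m) (pathLink m)ᵀ (pathAdj 2) := by
  ext i j
  rcases i with i | i <;> rcases j with j | j
  · simp [pathAdj]
  · have := i.isLt
    fin_cases j <;> simp [pathAdj, pathLink] <;> grind
  · have := j.isLt
    fin_cases i <;> simp [pathAdj, pathLink] <;> grind
  · fin_cases i <;> fin_cases j <;> simp [pathAdj]

theorem D1_add_two {m : ℕ} (hm : m ≠ 0) :
    (D1 (m + 2)).submatrix finSumFinEquiv finSumFinEquiv = fromBlocks (D1 m) 0 0 0 := by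
  ext i j
  rcases i with i | i <;> rcases j with j | j <;>
    simp only [D1, Matrix.submatrix_apply, Matrix.of_apply, finSumFinEquiv_apply_left,
      finSumFinEquiv_apply_right, Matrix.fromBlocks_apply₁₁, Matrix.fromBlocks_apply₁₂,
      Matrix.fromBlocks_apply₂₁, Matrix.fromBlocks_apply₂₂, Matrix.zero_apply, Fin.ext_iff,
      Fin.val_castAdd, Fin.val_natAdd]
  all_goals rw [if_neg (by omega)]

section

variable {n : ℕ} (A : Matrix (Fin n) (Fin n) ℝ)

/-- The adjacency matrix of the rooted product with `P_m`. -/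
noncomputable def rootedAdj (m : ℕ) : Matrix (Fin m × Fin n) (Fin m × Fin n) ℝ :=
  pathAdj m ⊗ₖ (1 : Matrix (Fin n) (Fin n) ℝ) + D1 m ⊗ₖ A

theorem det_rootedAdj_one : (rootedAdj A 1).det = A.det := by
  have hP : pathAdj 1 = 0 := by
    ext i j
    fin_cases i; fin_cases j; simp [pathAdj]
  have hD : D1 1 = 1 := by
    ext i j
    fin_cases i; fin_cases j; simp [D1]
  simp [rootedAdj, hP, hD, Matrix.det_kronecker]

theorem det_rootedAdj_two_sq : (rootedAdj A 2).det ^ 2 = 1 := by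
  let N : Matrix (Fin 2) (Fin 2) ℝ := !![0, 1; 0, 0]
  let E : Matrix (Fin 2) (Fin 2) ℝ := !![0, 0; 0, 1]
  have hEN : E * N = 0 := by ext i j; fin_cases i <;> fin_cases j <;> simp [E, N, Matrix.mul_apply]
  have hNE : N * E = N := by ext i j; fin_cases i <;> fin_cases j <;> simp [E, N, Matrix.mul_apply]
  have hN : N * pathAdj 2 = D1 2 := by
    ext i j
    fin_cases i <;> fin_cases j <;> simp [N, pathAdj, D1, Matrix.mul_apply]
  have hfac : rootedAdj A 2 =
      (1 + (N ⊗ₖ A) * (E ⊗ₖ 1)) * (pathAdj 2 ⊗ₖ (1 : Matrix (Fin n) (Fin n) ℝ)) := by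
    rw [← Matrix.mul_kronecker_mul, hNE, add_mul, one_mul, ← Matrix.mul_kronecker_mul, hN,
      mul_one, mul_one, rootedAdj]
  rw [hfac, Matrix.det_mul, Matrix.det_one_add_mul_comm, ← Matrix.mul_kronecker_mul, hEN,
    Matrix.zero_kronecker, add_zero, Matrix.det_one, one_mul, det_pathAdj_two_kronecker_one_sq]

theorem det_rootedAdj_add_two_sq {m : ℕ} (hm : m ≠ 0) :
    (rootedAdj A (m + 2)).det ^ 2 = (rootedAdj A m).det ^ 2 := by
  let e : (Fin m × Fin n) ⊕ (Fin 2 × Fin n) ≃ Fin (m + 2) × Fin n :=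
    (Equiv.sumProdDistrib _ _ _).symm.trans (finSumFinEquiv.prodCongr (Equiv.refl _))
  have hblocks : (rootedAdj A (m + 2)).submatrix e e =
      fromBlocks (rootedAdj A m) (pathLink m ⊗ₖ 1) ((pathLink m)ᵀ ⊗ₖ 1) (pathAdj 2 ⊗ₖ 1) := by
    ext i j
    have hP (a b) := congrFun₂ (pathAdj_add_two m) a b
    have hD (a b) := congrFun₂ (D1_add_two hm) a b
    simp only [Matrix.submatrix_apply] at hP hD
    rcases i with ⟨i, k⟩ | ⟨i, k⟩ <;> rcases j with ⟨j, l⟩ | ⟨j, l⟩ <;>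
      simp [e, rootedAdj, hP, hD, -finSumFinEquiv_apply_left, -finSumFinEquiv_apply_right]
  rw [← Matrix.det_submatrix_equiv_self e, hblocks, det_fromBlocks_of_mul_mul_eq_zero, mul_pow,
    det_pathAdj_two_kronecker_one_sq, one_mul]
  · rw [← Matrix.mul_kronecker_mul, pathAdj_two_mul_self, mul_one, Matrix.one_kronecker_one]
  · rw [← Matrix.mul_kronecker_mul, ← Matrix.mul_kronecker_mul,
      pathLink_mul_pathAdj_mul_transpose, Matrix.zero_kronecker]

theorem det_rootedAdj_sq (hA : A.det ^ 2 = 1) :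
    ∀ m : ℕ, m ≠ 0 → (rootedAdj A m).det ^ 2 = 1
  | 1, _ => by rw [det_rootedAdj_one, hA]
  | 2, _ => det_rootedAdj_two_sq A
  | m + 3, _ => by
    rw [det_rootedAdj_add_two_sq A m.succ_ne_zero, det_rootedAdj_sq hA (m + 1) m.succ_ne_zero]

end

theorem charpoly_coeff_zero_sq {ι R : Type*} [Fintype ι] [DecidableEq ι] [CommRing R]
    (M : Matrix ι ι R) : M.charpoly.coeff 0 ^ 2 = M.det ^ 2 := by
  rw [Matrix.det_eq_sign_charpoly_coeff, mul_pow, ← pow_mul, mul_comm _ 2, pow_mul]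
  simp

theorem rooted_product_charpoly_constant_term {n : ℕ}
    (A : Matrix (Fin n) (Fin n) ℝ)
    (ha0 : A.charpoly.coeff 0 = 1 ∨ A.charpoly.coeff 0 = -1)
    (m : ℕ) (hm : 2 ≤ m)
    (Atil : Matrix (Fin m × Fin n) (Fin m × Fin n) ℝ)
    (hAtil : Atil = pathAdj m ⊗ₖ (1 : Matrix (Fin n) (Fin n) ℝ) + D1 m ⊗ₖ A) :
    Atil.charpoly.coeff 0 = 1 ∨ Atil.charpoly.coeff 0 = -1 := by
  rw [← sq_eq_one_iff, charpoly_coeff_zero_sq] at ha0 ⊢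
  rw [hAtil]
  exact det_rootedAdj_sq A ha0 m (by omega)
end

section
/- Let G be a simple graph on n vertices with adjacency matrix A (an integer symmetric 0–1 matrix with zero diagonal), and let W = [e, Ae, …, A^{n−1}e] be its walk matrix over ℤ. Then 2^⌊n/2⌋ divides det W. -/
open Matrix

/-- The walk matrix `[e, Me, M²e, …, M^{N-1}e]` of an `N × N` integer matrix `M`. -/
def walkMatrixInt {N : ℕ} (M : Matrix (Fin N) (Fin N) ℤ) :
    Matrix (Fin N) (Fin N) ℤ :=
  Matrix.of fun i k => (M ^ (k : ℕ)).mulVec (fun _ => (1 : ℤ)) i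

/-- An alternating bilinear form in characteristic two vanishes on the diagonal. -/
theorem Matrix.IsSymm.dotProduct_mulVec_self_eq_zero {ι R : Type*} [Fintype ι] [CommRing R]
    [CharP R 2] {B : Matrix ι ι R} (hB : B.IsSymm) (hdiag : ∀ i, B i i = 0) (x : ι → R) :
    x ⬝ᵥ B *ᵥ x = 0 := by
  simp only [dotProduct, mulVec, Finset.mul_sum]
  rw [← Finset.sum_product']
  refine Finset.sum_involution (fun p _ => (p.2, p.1)) ?_ ?_ ?_ ?_
  · rintro ⟨i, j⟩ -
    have h : x j * (B j i * x i) = x i * (B i j * x j) := by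
      rw [hB.apply i j]; ring
    simp only [h, CharTwo.add_self_eq_zero]
  · rintro ⟨i, j⟩ - h hij
    obtain rfl : j = i := congrArg Prod.fst hij
    simp [hdiag] at h
  · simp
  · simp

theorem Matrix.IsSymm.mulVec_dotProduct_mulVec_pow {ι R : Type*} [Fintype ι] [DecidableEq ι]
    [CommRing R] {B : Matrix ι ι R} (hB : B.IsSymm) (x y : ι → R) (i j : ℕ) :
    (B ^ i *ᵥ x) ⬝ᵥ (B ^ j *ᵥ y) = x ⬝ᵥ B ^ (i + j) *ᵥ y := by
  rw [pow_add, ← mulVec_mulVec, dotProduct_mulVec x, ← mulVec_transpose, (hB.pow i).eq]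

/-- A graph has an even number of walks of any given positive length. -/
theorem Matrix.IsSymm.one_dotProduct_pow_mulVec_one_eq_zero {ι : Type*} [Fintype ι]
    [DecidableEq ι] {B : Matrix ι ι (ZMod 2)} (hB : B.IsSymm) (hdiag : ∀ i, B i i = 0)
    {k : ℕ} (hk : k ≠ 0) : (1 : ι → ZMod 2) ⬝ᵥ B ^ k *ᵥ 1 = 0 := by
  induction k using Nat.strong_induction_on with
  | _ k ih =>
    obtain ⟨j, rfl | rfl⟩ := Nat.even_or_odd' k
    · rw [two_mul, ← hB.mulVec_dotProduct_mulVec_pow]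
      have hsq : ∀ y : ι → ZMod 2, y ⬝ᵥ y = 1 ⬝ᵥ y := fun y => by
        have h : ∀ a : ZMod 2, a * a = a := by decide
        simp [dotProduct, h]
      rw [hsq]
      exact ih j (by omega) (by omega)
    · have h := hB.dotProduct_mulVec_self_eq_zero hdiag (B ^ j *ᵥ 1)
      rwa [mulVec_mulVec, ← pow_succ', hB.mulVec_dotProduct_mulVec_pow,
        show j + (j + 1) = 2 * j + 1 by ring] at h

theorem Int.two_pow_dvd_of_two_pow_dvd_sq (k : ℕ) (d : ℤ) (h : (2 : ℤ) ^ k ∣ d ^ 2) :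
    (2 : ℤ) ^ ((k + 1) / 2) ∣ d := by
  induction k using Nat.twoStepInduction generalizing d with
  | zero => simp
  | one => simpa using Int.prime_two.dvd_of_dvd_pow (by simpa using h)
  | more k ih _ =>
    obtain ⟨c, rfl⟩ : (2 : ℤ) ∣ d :=
      Int.prime_two.dvd_of_dvd_pow ((dvd_pow_self 2 (by omega)).trans h)
    rw [show (k + 2 + 1) / 2 = (k + 1) / 2 + 1 by omega, pow_succ']
    refine mul_dvd_mul_left 2 (ih c ?_)
    rw [pow_add, mul_pow, mul_comm] at h
    exact (mul_dvd_mul_iff_left (by norm_num)).1 h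

/-- If all rows but the first are divisible by `a`, then `a ^ n` divides the determinant. -/
theorem Matrix.pow_dvd_det_of_dvd_succ {R : Type*} [CommRing R] {n : ℕ} (a : R)
    (M : Matrix (Fin (n + 1)) (Fin (n + 1)) R) (h : ∀ i j, a ∣ M (Fin.succ i) j) :
    a ^ n ∣ M.det := by
  choose c hc using h
  have hM : M = of fun i j => (Fin.cons 1 fun _ => a : Fin (n + 1) → R) i *
      (Fin.cons (M 0) c : Fin (n + 1) → Fin (n + 1) → R) i j := by
    ext i j
    cases i using Fin.cases <;> simp [hc]
  have hdet := det_mul_column (Fin.cons 1 fun _ => a : Fin (n + 1) → R)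
    (of (Fin.cons (M 0) c : Fin (n + 1) → Fin (n + 1) → R))
  rw [hM]
  simp only [of_apply] at hdet
  rw [hdet, Fin.prod_univ_succ]
  simp

theorem two_pow_dvd_det_walkMatrix {n : ℕ} (A : Matrix (Fin n) (Fin n) ℤ)
    (hsym : A.IsSymm) (h01 : ∀ i j, A i j = 0 ∨ A i j = 1) (hdiag : ∀ i, A i i = 0) :
    (2 : ℤ) ^ (n / 2) ∣ (walkMatrixInt A).det := by
  obtain _ | n := n
  · simp
  refine Int.two_pow_dvd_of_two_pow_dvd_sq n _ ?_
  have hsq : (walkMatrixInt A).det ^ 2 = ((walkMatrixInt A)ᵀ * walkMatrixInt A).det := by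
    rw [det_mul, det_transpose, sq]
  rw [hsq]
  refine pow_dvd_det_of_dvd_succ 2 _ fun i j => ?_
  have hentry : ((walkMatrixInt A)ᵀ * walkMatrixInt A) i.succ j =
      1 ⬝ᵥ A ^ ((i.succ : ℕ) + j) *ᵥ 1 := by
    rw [← hsym.mulVec_dotProduct_mulVec_pow]
    rfl
  rw [hentry]
  refine (ZMod.intCast_zmod_eq_zero_iff_dvd _ 2).1 ?_
  have hcast := (hsym.map (Int.castRingHom (ZMod 2))).one_dotProduct_pow_mulVec_one_eq_zero
    (by simp [hdiag]) (k := (i.succ : ℕ) + j) (by simp)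
  have hpow : A.map (Int.castRingHom (ZMod 2)) ^ ((i.succ : ℕ) + j) =
      (A ^ ((i.succ : ℕ) + j)).map (Int.castRingHom (ZMod 2)) :=
    (map_pow (Int.castRingHom (ZMod 2)).mapMatrix A _).symm
  rw [hpow] at hcast
  simpa [dotProduct, mulVec] using hcast
end
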